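/- arXiv:2212.11221 — 2 statements merged into one kernel-verified Lean document; each statement's English description precedes it below -/
import Mathlib

section
/- There exist a universal constant c > 0 and d₀ such that for all d ≥ d₀ and all positive integers m ≤ c·d²/log⁴(d), if v⁽¹⁾, …, v⁽ᵐ⁾ are i.i.d. uniformly random points on the unit sphere S^{d−1} ⊆ ℝ^d and A′ is the m×m matrix with A′_{i,i} = 0 and A′_{i,j} = 2·Σ_{1 ≤ k < ℓ ≤ d} v⁽ⁱ⁾_k v⁽ⁱ⁾_ℓ v⁽ʲ⁾_k v⁽ʲ⁾_ℓ for i ≠ j, then Pr(‖A′‖₂ ≤ 1/4) ≥ 1 − 1/d. -/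
open MeasureTheory Metric ProbabilityTheory

/-- The uniform (rotation-invariant) probability distribution on the unit sphere of `ℝ^d`,
viewed as a measure on the ambient space. -/
noncomputable def uniformSphere (d : ℕ) : Measure (EuclideanSpace ℝ (Fin d)) :=
  ((volume : Measure (EuclideanSpace ℝ (Fin d))).toSphere Set.univ)⁻¹ •
    Measure.map Subtype.val ((volume : Measure (EuclideanSpace ℝ (Fin d))).toSphere)

/-- The operator (spectral) norm of a real matrix, i.e. the `ℓ² → ℓ²` operator norm. -/
noncomputable def opNorm {n : ℕ} (A : Matrix (Fin n) (Fin n) ℝ) : ℝ :=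
  ‖LinearMap.toContinuousLinearMap (Matrix.toEuclideanLin A)‖

section OffDiagonalGram

open Matrix
open scoped RealInnerProductSpace Pointwise

section Sequences

variable {a α b F : ℕ → ℝ} {L θ : ℝ} {P : ℕ}

lemma recurrence_nonneg (hF0 : F 0 = 0) (hF1 : F 1 = 0)
    (hF : ∀ p, F (p + 2) = α p + θ * F p) (hθ : 0 ≤ θ) (hα0 : ∀ s, 0 ≤ α s) (p : ℕ) :
    0 ≤ F p := by
  induction p using Nat.twoStepInduction with
  | zero => exact hF0.ge
  | one => exact hF1.ge
  | more p ih _ => rw [hF]; exact add_nonneg (hα0 p) (mul_nonneg hθ ih)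

lemma mul_le_of_recurrence (hF0 : F 0 = 0) (hF1 : F 1 = 0)
    (hF : ∀ p, F (p + 2) = α p + θ * F p) (hθ : 0 ≤ θ) (hL : 0 ≤ L) (hα0 : ∀ s, 0 ≤ α s)
    (hα : ∀ s t, α s * α t ≤ L * α (s + t)) (s p : ℕ) : α s * F p ≤ L * F (s + p) := by
  have hnn := recurrence_nonneg hF0 hF1 hF hθ hα0
  induction p using Nat.twoStepInduction with
  | zero => rw [hF0, mul_zero]; exact mul_nonneg hL (hnn _)
  | one => rw [hF1, mul_zero]; exact mul_nonneg hL (hnn _)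
  | more p ih _ =>
    rw [← add_assoc, hF, hF]
    linear_combination hα s p + θ * ih

lemma abs_le_of_first_return (hF0 : F 0 = 0) (hF1 : F 1 = 0)
    (hF : ∀ p, F (p + 2) = α p + θ * F p) (hL : 0 ≤ L) (hα0 : ∀ s, 0 ≤ α s)
    (hα : ∀ s t, α s * α t ≤ L * α (s + t)) (ha : ∀ s, |a s| ≤ α s) (hb0 : b 0 = 1)
    (hb1 : b 1 = 0) (hb : ∀ p, b (p + 2) = ∑ s ∈ Finset.range (p + 1), a s * b (p - s))
    (hθ : P * L ≤ θ) {p : ℕ} (hp : 1 ≤ p) (hpP : p ≤ P) : |b p| ≤ F p := by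
  have hθ0 : 0 ≤ θ := le_trans (by positivity) hθ
  have hnn := recurrence_nonneg hF0 hF1 hF hθ0 hα0
  induction p using Nat.strong_induction_on with
  | _ p ih =>
    match p, hp with
    | 1, _ => rw [hb1, hF1, abs_zero]
    | p + 2, _ =>
      rw [hb, hF, Finset.sum_range_succ, Nat.sub_self, hb0, mul_one, add_comm (α p)]
      refine (abs_add_le _ _).trans (add_le_add ?_ (ha p))
      have h1 : ∀ s ∈ Finset.range p, |a s * b (p - s)| ≤ L * F p := by
        intro s hs
        have hs' := Finset.mem_range.1 hs
        rw [abs_mul]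
        calc |a s| * |b (p - s)| ≤ α s * F (p - s) :=
              mul_le_mul (ha s) (ih _ (by lia) (by lia) (by lia)) (abs_nonneg _) (hα0 s)
          _ ≤ L * F (s + (p - s)) := mul_le_of_recurrence hF0 hF1 hF hθ0 hL hα0 hα s _
          _ = L * F p := by rw [Nat.add_sub_cancel' hs'.le]
      refine (Finset.abs_sum_le_sum_abs _ _).trans ((Finset.sum_le_card_nsmul _ _ _ h1).trans ?_)
      rw [Finset.card_range, nsmul_eq_mul, ← mul_assoc]
      refine mul_le_mul_of_nonneg_right (le_trans ?_ hθ) (hnn p)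
      exact mul_le_mul_of_nonneg_right (by exact_mod_cast (by lia : p ≤ P)) hL

end Sequences

/-- Spectral weights of a vector with respect to a real symmetric matrix. -/
lemma exists_spectral_weights {n : Type*} [Fintype n] [DecidableEq n] {B : Matrix n n ℝ}
    (hB : B.IsHermitian) (g : n → ℝ) :
    ∃ c : n → ℝ, (∀ k, 0 ≤ c k) ∧
      ∀ s : ℕ, g ⬝ᵥ (B ^ s *ᵥ g) = ∑ k, c k * hB.eigenvalues k ^ s := by
  set U : Matrix n n ℝ := (hB.eigenvectorUnitary : Matrix n n ℝ)
  have hpow (s : ℕ) : B ^ s = U * diagonal (fun k => hB.eigenvalues k ^ s) * Uᵀ := by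
    conv_lhs => rw [hB.spectral_theorem, ← map_pow, Unitary.conjStarAlgAut_apply, diagonal_pow]
    rfl
  refine ⟨fun k => (g ᵥ* U) k ^ 2, fun k => sq_nonneg _, fun s => ?_⟩
  rw [hpow, ← mulVec_mulVec, ← mulVec_mulVec, dotProduct_mulVec, mulVec_transpose]
  simp only [dotProduct, mulVec_diagonal]
  exact Finset.sum_congr rfl fun k _ => by ring

lemma trace_pow_eq_sum_eigenvalues {n : Type*} [Fintype n] [DecidableEq n] {B : Matrix n n ℝ}
    (hB : B.IsHermitian) (s : ℕ) : (B ^ s).trace = ∑ k, hB.eigenvalues k ^ s := by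
  conv_lhs => rw [hB.spectral_theorem, ← map_pow, Unitary.conjStarAlgAut_apply, diagonal_pow]
  rw [trace_mul_comm, ← mul_assoc]
  simp [trace, Matrix.diag]

open scoped Matrix.Norms.L2Operator in
lemma l2_opNorm_le_of_trace_pow_le {n : Type*} [Fintype n] [DecidableEq n] {A : Matrix n n ℝ}
    (hA : A.IsHermitian) {r : ℝ} (hr : 0 ≤ r) {p : ℕ} (hp : Even p) (hp0 : p ≠ 0)
    (h : (A ^ p).trace ≤ r ^ p) : ‖A‖ ≤ r := by
  have key : ‖A‖ = ‖diagonal (hA.eigenvalues)‖ := by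
    conv_lhs => rw [hA.spectral_theorem, Unitary.conjStarAlgAut_apply, ← Unitary.coe_star,
      CStarRing.norm_mul_coe_unitary, CStarRing.norm_coe_unitary_mul]
    rfl
  rw [key, l2_opNorm_diagonal, pi_norm_le_iff_of_nonneg hr]
  intro i
  rw [Real.norm_eq_abs]
  refine le_of_pow_le_pow_left₀ hp0 hr ?_
  rw [hp.pow_abs]
  refine le_trans ?_ ((trace_pow_eq_sum_eigenvalues hA p).symm.trans_le h)
  exact Finset.single_le_sum (f := fun k => hA.eigenvalues k ^ p) (fun k _ => hp.pow_nonneg _)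
    (Finset.mem_univ i)

/-- Chebyshev's sum inequality for the absolute moments of a finite measure on the line. -/
lemma sum_mul_abs_pow_mul_le {n : Type*} [Fintype n] {c x : n → ℝ} (hc : ∀ k, 0 ≤ c k)
    (s t : ℕ) : (∑ k, c k * |x k| ^ s) * (∑ k, c k * |x k| ^ t) ≤
      (∑ k, c k) * ∑ k, c k * |x k| ^ (s + t) := by
  have h : 0 ≤ ∑ k, ∑ l, c k * c l * ((|x k| ^ s - |x l| ^ s) * (|x k| ^ t - |x l| ^ t)) := by
    refine Finset.sum_nonneg fun k _ => Finset.sum_nonneg fun l _ =>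
      mul_nonneg (mul_nonneg (hc k) (hc l)) ?_
    rcases le_total |x k| |x l| with hkl | hkl
    · exact mul_nonneg_of_nonpos_of_nonpos
        (sub_nonpos.2 (pow_le_pow_left₀ (abs_nonneg _) hkl _))
        (sub_nonpos.2 (pow_le_pow_left₀ (abs_nonneg _) hkl _))
    · exact mul_nonneg (sub_nonneg.2 (pow_le_pow_left₀ (abs_nonneg _) hkl _))
        (sub_nonneg.2 (pow_le_pow_left₀ (abs_nonneg _) hkl _))
  have e : ∑ k, ∑ l, c k * c l * ((|x k| ^ s - |x l| ^ s) * (|x k| ^ t - |x l| ^ t)) =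
      2 * ((∑ k, c k) * ∑ k, c k * |x k| ^ (s + t)) -
        2 * ((∑ k, c k * |x k| ^ s) * (∑ k, c k * |x k| ^ t)) := by
    have e1 : ∑ k, ∑ l, c k * c l * ((|x k| ^ s - |x l| ^ s) * (|x k| ^ t - |x l| ^ t)) =
        ∑ k, ∑ l, ((c k * |x k| ^ (s + t)) * c l + c k * (c l * |x l| ^ (s + t))
          - (c k * |x k| ^ s) * (c l * |x l| ^ t) - (c k * |x k| ^ t) * (c l * |x l| ^ s)) :=
      Finset.sum_congr rfl fun k _ => Finset.sum_congr rfl fun l _ => by ring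
    rw [e1]
    simp only [Finset.sum_sub_distrib, Finset.sum_add_distrib, ← Finset.sum_mul_sum]
    ring
  linarith

/-- First-return decomposition of a diagonal entry of a power of a symmetric matrix. -/
lemma pow_add_two_apply_self_eq_sum {n : ℕ} {A : Matrix (Fin (n + 1)) (Fin (n + 1)) ℝ}
    (hA : A.IsSymm) (i : Fin (n + 1)) (hi : A i i = 0) (p : ℕ) :
    (A ^ (p + 2)) i i = ∑ s ∈ Finset.range (p + 1),
      ((fun j => A i (i.succAbove j)) ⬝ᵥ
        (A.submatrix i.succAbove i.succAbove ^ s *ᵥ fun j => A i (i.succAbove j))) *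
          (A ^ (p - s)) i i := by
  set g : Fin n → ℝ := fun j => A i (i.succAbove j)
  set B := A.submatrix i.succAbove i.succAbove
  have hc : ∀ p, (fun j => (A ^ p) (i.succAbove j) i) =
      ∑ s ∈ Finset.range p, (A ^ (p - 1 - s)) i i • (B ^ s *ᵥ g) := by
    intro p
    induction p with
    | zero => ext j; simp [Fin.succAbove_ne]
    | succ p ih =>
      have h1 : (fun j => (A ^ (p + 1)) (i.succAbove j) i) =
          (A ^ p) i i • g + B *ᵥ fun j => (A ^ p) (i.succAbove j) i := by
        ext j
        rw [pow_succ', Matrix.mul_apply, Fin.sum_univ_succAbove _ i]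
        simp only [Pi.add_apply, Pi.smul_apply, smul_eq_mul, mulVec, dotProduct, B, g,
          submatrix_apply]
        rw [hA.apply i (i.succAbove j), mul_comm]
      rw [h1, ih, Finset.sum_range_succ', add_comm, mulVec_sum]
      congr 1
      · refine Finset.sum_congr rfl fun s _ => ?_
        rw [mulVec_smul, mulVec_mulVec, ← pow_succ', Nat.add_sub_cancel, Nat.sub_sub, add_comm 1 s]
      · simp
  rw [pow_succ', Matrix.mul_apply, Fin.sum_univ_succAbove _ i, hi, zero_mul, zero_add]
  change g ⬝ᵥ (fun j => (A ^ (p + 1)) (i.succAbove j) i) = _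
  rw [hc, dotProduct_sum]
  exact Finset.sum_congr rfl fun s _ => by rw [dotProduct_smul, smul_eq_mul, mul_comm]; simp

/-- The bound for the diagonal entry of the `2 q`-th power of a bordered symmetric matrix,
with border `g` and remaining block `B`. -/
noncomputable def returnBound {n : Type*} [Fintype n] [DecidableEq n] (θ : ℝ) (g : n → ℝ)
    (B : Matrix n n ℝ) : ℕ → ℝ
  | 0 => 0
  | q + 1 => g ⬝ᵥ (B ^ (2 * q) *ᵥ g) + θ * returnBound θ g B q

lemma dotProduct_even_pow_mulVec {n : Type*} [Fintype n] [DecidableEq n] {B : Matrix n n ℝ}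
    (hB : B.IsSymm) (g : n → ℝ) (q : ℕ) :
    g ⬝ᵥ (B ^ (2 * q) *ᵥ g) = (B ^ q *ᵥ g) ⬝ᵥ (B ^ q *ᵥ g) := by
  rw [two_mul, pow_add, ← mulVec_mulVec, dotProduct_mulVec, ← mulVec_transpose, (hB.pow q).eq]

lemma dotProduct_even_pow_mulVec_nonneg {n : Type*} [Fintype n] [DecidableEq n]
    {B : Matrix n n ℝ} (hB : B.IsSymm) (g : n → ℝ) (q : ℕ) :
    0 ≤ g ⬝ᵥ (B ^ (2 * q) *ᵥ g) := by
  rw [dotProduct_even_pow_mulVec hB]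
  exact Finset.sum_nonneg fun k _ => mul_self_nonneg _

lemma returnBound_nonneg {n : Type*} [Fintype n] [DecidableEq n] {θ : ℝ} (hθ : 0 ≤ θ)
    {B : Matrix n n ℝ} (hB : B.IsSymm) (g : n → ℝ) (q : ℕ) : 0 ≤ returnBound θ g B q := by
  induction q with
  | zero => exact le_rfl
  | succ q ih =>
    exact add_nonneg (dotProduct_even_pow_mulVec_nonneg hB g q) (mul_nonneg hθ ih)

lemma pow_apply_self_le_returnBound {n : ℕ} {A : Matrix (Fin (n + 1)) (Fin (n + 1)) ℝ}
    (hA : A.IsSymm) (i : Fin (n + 1)) (hi : A i i = 0) {L θ : ℝ}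
    (hL : (fun j => A i (i.succAbove j)) ⬝ᵥ (fun j => A i (i.succAbove j)) ≤ L)
    {q : ℕ} (hq : 1 ≤ q) (hθ : (2 * q : ℕ) * L ≤ θ) :
    (A ^ (2 * q)) i i ≤ returnBound θ (fun j => A i (i.succAbove j))
      (A.submatrix i.succAbove i.succAbove) q := by
  set g : Fin n → ℝ := fun j => A i (i.succAbove j)
  set B := A.submatrix i.succAbove i.succAbove
  have hB : B.IsHermitian := by
    have : B.IsSymm := hA.submatrix _
    rwa [IsHermitian, conjTranspose_eq_transpose_of_trivial]
  obtain ⟨c, hc, hcs⟩ := exists_spectral_weights hB g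
  set x := hB.eigenvalues
  have hc0 : ∑ k, c k ≤ L := by
    have := hcs 0
    simp only [pow_zero, mul_one, one_mulVec] at this
    exact this.symm.trans_le hL
  have hα0 : ∀ s, 0 ≤ ∑ k, c k * |x k| ^ s := fun s =>
    Finset.sum_nonneg fun k _ => mul_nonneg (hc k) (by positivity)
  let F : ℕ → ℝ := fun p => (Nat.rec (motive := fun _ => ℝ × ℝ) (0, 0)
    (fun p z => (z.2, (∑ k, c k * |x k| ^ p) + θ * z.1)) p).1
  have hF : ∀ p, F (p + 2) = (∑ k, c k * |x k| ^ p) + θ * F p := fun p => rfl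
  have key : |(A ^ (2 * q)) i i| ≤ F (2 * q) := by
    refine abs_le_of_first_return (a := fun s => g ⬝ᵥ (B ^ s *ᵥ g))
      (α := fun s => ∑ k, c k * |x k| ^ s) (b := fun p => (A ^ p) i i) (L := L) (P := 2 * q)
      rfl rfl hF ((Finset.sum_nonneg fun k _ => hc k).trans hc0) hα0 ?_ ?_ (by simp)
      (by simpa using hi) (fun p => pow_add_two_apply_self_eq_sum hA i hi p) hθ (by lia) le_rfl
    · intro s t
      exact (sum_mul_abs_pow_mul_le hc s t).trans (mul_le_mul_of_nonneg_right hc0 (hα0 _))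
    · intro s
      simp only [hcs]
      refine (Finset.abs_sum_le_sum_abs _ _).trans_eq (Finset.sum_congr rfl fun k _ => ?_)
      rw [abs_mul, abs_pow, abs_of_nonneg (hc k)]
  have hFG : ∀ q, F (2 * q) = returnBound θ g B q := by
    intro q
    induction q with
    | zero => rfl
    | succ q ih =>
      rw [mul_add, mul_one, hF, ih, returnBound, hcs]
      congr 1
      exact Finset.sum_congr rfl fun k _ => by rw [(even_two_mul q).pow_abs]
  rw [← hFG]
  exact (le_abs_self _).trans key

section Gram

variable {X κ : Type*} [Fintype κ] (φ : X → κ → ℝ)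

/-- The Gram matrix of the vectors `φ (v i)` with its diagonal replaced by zero. -/
def offGram {n : ℕ} (v : Fin n → X) : Matrix (Fin n) (Fin n) ℝ :=
  Matrix.of fun i j => if i = j then 0 else φ (v i) ⬝ᵥ φ (v j)

/-- The configurations whose feature vectors have norm at most one and whose off-diagonal Gram
entries are at most `β` in absolute value. -/
def goodSet (β : ℝ) (n : ℕ) : Set (Fin n → X) :=
  {v | (∀ i, φ (v i) ⬝ᵥ φ (v i) ≤ 1) ∧ ∀ i j, |offGram φ v i j| ≤ β}

variable {φ}

lemma offGram_isSymm {n : ℕ} (v : Fin n → X) : (offGram φ v).IsSymm := by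
  ext i j
  simp only [offGram, transpose_apply, of_apply, eq_comm (a := j), dotProduct_comm (φ (v j))]

lemma offGram_apply_self {n : ℕ} (v : Fin n → X) (i : Fin n) : offGram φ v i i = 0 := by
  simp [offGram]

lemma offGram_insertNth_submatrix {n : ℕ} (i : Fin (n + 1)) (x : X) (v : Fin n → X) :
    (offGram φ (i.insertNth x v : Fin (n + 1) → X)).submatrix i.succAbove i.succAbove =
      offGram φ v := by
  ext j k
  simp [offGram]

lemma offGram_insertNth_row {n : ℕ} (i : Fin (n + 1)) (x : X) (v : Fin n → X) (j : Fin n) :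
    offGram φ (i.insertNth x v : Fin (n + 1) → X) i (i.succAbove j) = φ x ⬝ᵥ φ (v j) := by
  simp [offGram, (Fin.succAbove_ne i j).symm]

lemma goodSet_of_insertNth {n : ℕ} {β : ℝ} {i : Fin (n + 1)} {x : X} {v : Fin n → X}
    (h : (i.insertNth x v : Fin (n + 1) → X) ∈ goodSet φ β (n + 1)) : v ∈ goodSet φ β n := by
  refine ⟨fun j => by simpa using h.1 (i.succAbove j), fun j k => ?_⟩
  rw [← offGram_insertNth_submatrix i x v]
  exact h.2 _ _

lemma row_dotProduct_self_le {n : ℕ} {β : ℝ} {v : Fin (n + 1) → X}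
    (h : v ∈ goodSet φ β (n + 1)) (i : Fin (n + 1)) :
    (fun j => offGram φ v i (i.succAbove j)) ⬝ᵥ (fun j => offGram φ v i (i.succAbove j)) ≤
      n * β ^ 2 := by
  have : ∀ j ∈ Finset.univ, offGram φ v i (i.succAbove j) * offGram φ v i (i.succAbove j) ≤
      β ^ 2 := fun j _ => by
    rw [← abs_mul_abs_self, ← sq]
    exact pow_le_pow_left₀ (abs_nonneg _) (h.2 _ _) 2
  simpa [dotProduct] using Finset.sum_le_card_nsmul _ _ _ this

lemma trace_even_pow_nonneg {n : Type*} [Fintype n] [DecidableEq n] {B : Matrix n n ℝ}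
    (hB : B.IsSymm) (q : ℕ) (i : n) : 0 ≤ (B ^ (2 * q)) i i := by
  have := dotProduct_even_pow_mulVec_nonneg hB (Pi.single i 1) q
  simpa using this

lemma trace_pow_mul_gram_le {n : ℕ} {v : Fin n → X} (h : ∀ i, φ (v i) ⬝ᵥ φ (v i) ≤ 1) (q : ℕ) :
    ∑ j, ((offGram φ v ^ q * Matrix.of fun i => φ (v i)) j ⬝ᵥ
        (offGram φ v ^ q * Matrix.of fun i => φ (v i)) j) ≤
      3 / 2 * (offGram φ v ^ (2 * q)).trace + 1 / 2 * (offGram φ v ^ (2 * (q + 1))).trace := by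
  set B := offGram φ v
  set W : Matrix (Fin n) κ ℝ := Matrix.of fun i => φ (v i)
  have hB : B.IsSymm := offGram_isSymm v
  have hW : W * Wᵀ = B + diagonal fun i => φ (v i) ⬝ᵥ φ (v i) := by
    ext i j
    by_cases hij : i = j
    · subst hij
      simp [W, B, offGram, Matrix.mul_apply, dotProduct]
    · simp [W, B, offGram, Matrix.mul_apply, dotProduct, hij]
  have h1 : ∑ j, ((B ^ q * W) j ⬝ᵥ (B ^ q * W) j) =
      (B ^ (2 * q + 1)).trace + ∑ i, (B ^ (2 * q)) i i * (φ (v i) ⬝ᵥ φ (v i)) := by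
    calc _ = ((B ^ q * W) * (B ^ q * W)ᵀ).trace := by
          simp only [trace, diag_apply, Matrix.mul_apply, dotProduct, transpose_apply]
      _ = (B ^ (2 * q) * (W * Wᵀ)).trace := by
          rw [transpose_mul, (hB.pow q).eq, ← Matrix.mul_assoc, trace_mul_comm, two_mul, pow_add]
          simp only [Matrix.mul_assoc]
      _ = _ := by
          rw [hW, mul_add, trace_add, ← pow_succ]
          simp [trace, mul_diagonal]
  have h2 : ∑ i, (B ^ (2 * q)) i i * (φ (v i) ⬝ᵥ φ (v i)) ≤ (B ^ (2 * q)).trace :=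
    Finset.sum_le_sum fun i _ =>
      (mul_le_mul_of_nonneg_left (h i) (trace_even_pow_nonneg hB q i)).trans_eq (mul_one _)
  have h3 : 0 ≤ (B ^ (2 * q)).trace - 2 * (B ^ (2 * q + 1)).trace + (B ^ (2 * (q + 1))).trace := by
    have : 0 ≤ ((B ^ q * (B - 1)) * (B ^ q * (B - 1))ᵀ).trace := by
      refine Finset.sum_nonneg fun i _ => ?_
      rw [diag_apply, Matrix.mul_apply]
      exact Finset.sum_nonneg fun j _ => mul_self_nonneg _
    have e : (B ^ q * (B - 1)) * (B ^ q * (B - 1))ᵀ =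
        B ^ (2 * q) - B ^ (2 * q + 1) - B ^ (2 * q + 1) + B ^ (2 * (q + 1)) := by
      have hc : B ^ q * (B - 1) = B ^ (q + 1) - B ^ q := by rw [mul_sub, mul_one, pow_succ]
      rw [hc, transpose_sub, (hB.pow _).eq, (hB.pow _).eq, sub_mul, mul_sub, mul_sub]
      simp only [← pow_add, two_mul, add_assoc, add_left_comm 1 q, add_comm 1 q]
      abel
    rw [e, trace_add, trace_sub, trace_sub] at this
    linarith
  rw [h1]
  linarith

variable [MeasurableSpace X]

lemma measurable_matrix_pow {Ω n : Type*} [MeasurableSpace Ω] [Fintype n] [DecidableEq n]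
    {f : Ω → Matrix n n ℝ} (hf : ∀ i j, Measurable fun ω => f ω i j) (p : ℕ) (i j : n) :
    Measurable fun ω => (f ω ^ p) i j := by
  induction p generalizing i j with
  | zero => simp
  | succ p ih =>
    simp only [pow_succ, Matrix.mul_apply]
    exact Finset.measurable_sum _ fun k _ => (ih i k).mul (hf k j)

lemma measurable_dotProduct {Ω n : Type*} [MeasurableSpace Ω] [Fintype n]
    {f g : Ω → n → ℝ} (hf : ∀ i, Measurable fun ω => f ω i) (hg : ∀ i, Measurable fun ω => g ω i) :
    Measurable fun ω => f ω ⬝ᵥ g ω :=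
  Finset.measurable_sum _ fun k _ => (hf k).mul (hg k)

lemma measurable_offGram (hφ : Measurable φ) {n : ℕ} (i j : Fin n) :
    Measurable fun v : Fin n → X => offGram φ v i j := by
  by_cases h : i = j
  · simp [offGram, h]
  · simp only [offGram, of_apply, h, if_false]
    have h1 : ∀ i : Fin n, Measurable fun v : Fin n → X => φ (v i) := fun i =>
      hφ.comp (measurable_pi_apply i)
    exact measurable_dotProduct (fun k => (measurable_pi_apply k).comp (h1 i))
      (fun k => (measurable_pi_apply k).comp (h1 j))

lemma measurableSet_goodSet (hφ : Measurable φ) (β : ℝ) (n : ℕ) :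
    MeasurableSet (goodSet φ β n) := by
  have h1 : ∀ (i : Fin n) k, Measurable fun v : Fin n → X => φ (v i) k := fun i k =>
    (measurable_pi_apply k).comp (hφ.comp (measurable_pi_apply i))
  have e : goodSet φ β n = (⋂ i, {v | φ (v i) ⬝ᵥ φ (v i) ≤ 1}) ∩
      ⋂ i, ⋂ j, {v | |offGram φ v i j| ≤ β} := by
    ext v
    simp [goodSet]
  rw [e]
  exact (MeasurableSet.iInter fun i =>
    measurableSet_le (measurable_dotProduct (h1 i) (h1 i)) measurable_const).inter
    (MeasurableSet.iInter fun i => MeasurableSet.iInter fun j =>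
      measurableSet_le (measurable_offGram hφ i j).abs measurable_const)

variable {ν : Measure X}

lemma lintegral_quadratic_le {σ : ℝ} (hφ : Measurable φ) (hσ0 : 0 ≤ σ)
    (hσ : ∀ y : κ → ℝ, ∫⁻ x, ENNReal.ofReal ((y ⬝ᵥ φ x) ^ 2) ∂ν ≤ ENNReal.ofReal (σ * (y ⬝ᵥ y)))
    {n : ℕ} {v : Fin n → X} (h : ∀ i, φ (v i) ⬝ᵥ φ (v i) ≤ 1) (q : ℕ) :
    ∫⁻ x, ENNReal.ofReal ((fun j => φ x ⬝ᵥ φ (v j)) ⬝ᵥ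
      (offGram φ v ^ (2 * q) *ᵥ fun j => φ x ⬝ᵥ φ (v j))) ∂ν ≤
    ENNReal.ofReal σ * (ENNReal.ofReal (3 / 2) * ENNReal.ofReal (offGram φ v ^ (2 * q)).trace +
      ENNReal.ofReal (1 / 2) * ENNReal.ofReal (offGram φ v ^ (2 * (q + 1))).trace) := by
  set Y := offGram φ v ^ q * Matrix.of fun i => φ (v i)
  have hB := offGram_isSymm (φ := φ) v
  have hg : ∀ x, (fun j => φ x ⬝ᵥ φ (v j)) ⬝ᵥ
      (offGram φ v ^ (2 * q) *ᵥ fun j => φ x ⬝ᵥ φ (v j)) = ∑ j, (Y j ⬝ᵥ φ x) ^ 2 := by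
    intro x
    have : (fun j => φ x ⬝ᵥ φ (v j)) = (Matrix.of fun i => φ (v i)) *ᵥ φ x := by
      ext j
      exact dotProduct_comm _ _
    rw [dotProduct_even_pow_mulVec hB, this, mulVec_mulVec]
    simp only [dotProduct, sq, mulVec, Y]
  have htr : ∀ q, 0 ≤ (offGram φ v ^ (2 * q)).trace := fun q =>
    Finset.sum_nonneg fun i _ => trace_even_pow_nonneg hB q i
  have hm : ∀ j, Measurable fun x => Y j ⬝ᵥ φ x := fun j =>
    measurable_dotProduct (f := fun _ => Y j) (g := φ) (fun _ => measurable_const)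
      fun k => (measurable_pi_apply k).comp hφ
  calc _ = ∑ j, ∫⁻ x, ENNReal.ofReal ((Y j ⬝ᵥ φ x) ^ 2) ∂ν := by
        simp only [hg]
        rw [← lintegral_finsetSum]
        · refine lintegral_congr fun x => ?_
          rw [ENNReal.ofReal_sum_of_nonneg fun j _ => sq_nonneg _]
        · intro j _
          exact ((hm j).pow_const 2).ennreal_ofReal
    _ ≤ ∑ j, ENNReal.ofReal (σ * (Y j ⬝ᵥ Y j)) := Finset.sum_le_sum fun j _ => hσ _
    _ = ENNReal.ofReal (σ * ∑ j, Y j ⬝ᵥ Y j) := by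
        rw [Finset.mul_sum, ENNReal.ofReal_sum_of_nonneg]
        exact fun j _ => mul_nonneg hσ0 (Finset.sum_nonneg fun k _ => mul_self_nonneg _)
    _ ≤ ENNReal.ofReal (σ * (3 / 2 * (offGram φ v ^ (2 * q)).trace +
          1 / 2 * (offGram φ v ^ (2 * (q + 1))).trace)) :=
        ENNReal.ofReal_le_ofReal (mul_le_mul_of_nonneg_left (trace_pow_mul_gram_le h q) hσ0)
    _ = _ := by
        have := htr q
        have := htr (q + 1)
        rw [ENNReal.ofReal_mul hσ0, ENNReal.ofReal_add (by positivity) (by positivity),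
          ENNReal.ofReal_mul (by norm_num), ENNReal.ofReal_mul (by norm_num)]

end Gram

lemma lintegral_pi_eq_lintegral_insertNth {X : Type*} [MeasurableSpace X] {ν : Measure X}
    [SigmaFinite ν] {n : ℕ} (i : Fin (n + 1)) {f : (Fin (n + 1) → X) → ENNReal}
    (hf : Measurable f) :
    ∫⁻ v, f v ∂(Measure.pi fun _ => ν) =
      ∫⁻ v, ∫⁻ x, f (i.insertNth x v) ∂ν ∂(Measure.pi fun _ : Fin n => ν) := by
  have h := (measurePreserving_piFinSuccAbove (fun _ : Fin (n + 1) => ν) i).symm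
  rw [← h.lintegral_comp hf, ← Function.comp_def f, lintegral_prod_symm' _ (hf.comp h.measurable)]
  rfl

section Moments

variable {X κ : Type*} [Fintype κ] {φ : X → κ → ℝ} [MeasurableSpace X] {ν : Measure X}

lemma setLIntegral_returnBound_le {σ β θ K : ℝ} (hφ : Measurable φ) (hσ0 : 0 ≤ σ)
    (hσ : ∀ y : κ → ℝ, ∫⁻ x, ENNReal.ofReal ((y ⬝ᵥ φ x) ^ 2) ∂ν ≤ ENNReal.ofReal (σ * (y ⬝ᵥ y)))
    (hθ0 : 0 ≤ θ) (hK : 0 ≤ K) (hK1 : K ≤ 1) (hθK : 2 * θ ≤ K ^ 2) {n Q : ℕ}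
    (ih : ∀ q ≤ Q, ∫⁻ v in goodSet φ β n, ENNReal.ofReal (offGram φ v ^ (2 * q)).trace
      ∂(Measure.pi fun _ => ν) ≤ ENNReal.ofReal (n * K ^ (2 * q)))
    {q : ℕ} (hq : q + 1 ≤ Q) :
    ∫⁻ v in goodSet φ β n, ∫⁻ x, ENNReal.ofReal
      (returnBound θ (fun j => φ x ⬝ᵥ φ (v j)) (offGram φ v) (q + 1)) ∂ν
      ∂(Measure.pi fun _ => ν) ≤ ENNReal.ofReal (4 * σ * n * K ^ (2 * q)) := by
  have hφk : ∀ k, Measurable fun x => φ x k := fun k => (measurable_pi_apply k).comp hφ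
  have htrm : ∀ q, Measurable fun v : Fin n → X =>
      ENNReal.ofReal (offGram φ v ^ (2 * q)).trace := fun q =>
    (Finset.measurable_sum _ fun i _ =>
      measurable_matrix_pow (measurable_offGram hφ) _ i i).ennreal_ofReal
  have hgm : ∀ v : Fin n → X, ∀ j, Measurable fun x => φ x ⬝ᵥ φ (v j) := fun v j =>
    measurable_dotProduct (f := φ) (g := fun _ => φ (v j)) hφk fun _ => measurable_const
  have ham : ∀ (v : Fin n → X) q, Measurable fun x => ENNReal.ofReal
      ((fun j => φ x ⬝ᵥ φ (v j)) ⬝ᵥ (offGram φ v ^ (2 * q) *ᵥ fun j => φ x ⬝ᵥ φ (v j))) :=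
    fun v q => (measurable_dotProduct (hgm v) fun i => measurable_dotProduct
      (f := fun _ => (offGram φ v ^ (2 * q)) i) (fun _ => measurable_const)
      (hgm v)).ennreal_ofReal
  have step : ∀ q, ∫⁻ v in goodSet φ β n, ∫⁻ x, ENNReal.ofReal
      (returnBound θ (fun j => φ x ⬝ᵥ φ (v j)) (offGram φ v) (q + 1)) ∂ν
      ∂(Measure.pi fun _ => ν) ≤
      ENNReal.ofReal σ * (ENNReal.ofReal (3 / 2) *
        (∫⁻ v in goodSet φ β n, ENNReal.ofReal (offGram φ v ^ (2 * q)).trace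
          ∂(Measure.pi fun _ => ν)) + ENNReal.ofReal (1 / 2) *
        ∫⁻ v in goodSet φ β n, ENNReal.ofReal (offGram φ v ^ (2 * (q + 1))).trace
          ∂(Measure.pi fun _ => ν)) +
      ENNReal.ofReal θ * ∫⁻ v in goodSet φ β n, ∫⁻ x, ENNReal.ofReal
        (returnBound θ (fun j => φ x ⬝ᵥ φ (v j)) (offGram φ v) q) ∂ν
        ∂(Measure.pi fun _ => ν) := by
    intro q
    have hm : Measurable fun v : Fin n → X => ENNReal.ofReal σ *
        (ENNReal.ofReal (3 / 2) * ENNReal.ofReal (offGram φ v ^ (2 * q)).trace +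
          ENNReal.ofReal (1 / 2) * ENNReal.ofReal (offGram φ v ^ (2 * (q + 1))).trace) :=
      (((htrm q).const_mul _).add ((htrm (q + 1)).const_mul _)).const_mul _
    rw [← lintegral_const_mul _ (htrm q), ← lintegral_const_mul _ (htrm (q + 1)),
      ← lintegral_add_left ((htrm q).const_mul _),
      ← lintegral_const_mul' _ _ ENNReal.ofReal_ne_top,
      ← lintegral_const_mul' _ _ ENNReal.ofReal_ne_top,
      ← lintegral_add_left hm]
    refine setLIntegral_mono' (measurableSet_goodSet hφ β n) fun v hv => ?_
    refine le_trans (le_of_eq ?_) (add_le_add_left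
      (lintegral_quadratic_le hφ hσ0 hσ hv.1 q) _)
    rw [← lintegral_const_mul' _ _ ENNReal.ofReal_ne_top, ← lintegral_add_left (ham v q)]
    refine lintegral_congr fun x => ?_
    rw [returnBound, ENNReal.ofReal_add, ENNReal.ofReal_mul hθ0]
    · exact dotProduct_even_pow_mulVec_nonneg (offGram_isSymm v) _ q
    · exact mul_nonneg hθ0 (returnBound_nonneg hθ0 (offGram_isSymm v) _ q)
  have hT : ∀ q, q + 1 ≤ Q → ENNReal.ofReal σ * (ENNReal.ofReal (3 / 2) *
        (∫⁻ v in goodSet φ β n, ENNReal.ofReal (offGram φ v ^ (2 * q)).trace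
          ∂(Measure.pi fun _ => ν)) + ENNReal.ofReal (1 / 2) *
        ∫⁻ v in goodSet φ β n, ENNReal.ofReal (offGram φ v ^ (2 * (q + 1))).trace
          ∂(Measure.pi fun _ => ν)) ≤ ENNReal.ofReal (2 * σ * n * K ^ (2 * q)) := by
    intro q hq
    calc _ ≤ ENNReal.ofReal σ * (ENNReal.ofReal (3 / 2) * ENNReal.ofReal (n * K ^ (2 * q)) +
          ENNReal.ofReal (1 / 2) * ENNReal.ofReal (n * K ^ (2 * (q + 1)))) := by
          gcongr
          · exact ih q (by lia)
          · exact ih _ hq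
      _ = ENNReal.ofReal (σ * (3 / 2 * (n * K ^ (2 * q)) + 1 / 2 * (n * K ^ (2 * (q + 1))))) := by
          rw [ENNReal.ofReal_mul hσ0, ENNReal.ofReal_add (by positivity) (by positivity),
            ENNReal.ofReal_mul (p := 3 / 2) (by norm_num),
            ENNReal.ofReal_mul (p := 1 / 2) (by norm_num)]
      _ ≤ _ := by
          refine ENNReal.ofReal_le_ofReal ?_
          have : K ^ (2 * (q + 1)) ≤ K ^ (2 * q) :=
            pow_le_pow_of_le_one hK hK1 (by lia)
          have h2 : σ * n * K ^ (2 * (q + 1)) ≤ σ * n * K ^ (2 * q) := by gcongr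
          linarith
  induction q with
  | zero =>
    refine (step 0).trans ((add_le_add_left (hT 0 hq) _).trans ?_)
    simp only [returnBound, ENNReal.ofReal_zero, lintegral_zero, mul_zero, add_zero, pow_zero]
    refine ENNReal.ofReal_le_ofReal ?_
    have : 0 ≤ σ * n := by positivity
    linarith
  | succ q ihq =>
    refine (step (q + 1)).trans ((add_le_add (hT (q + 1) hq)
      (mul_le_mul_right (ihq (by lia)) _)).trans ?_)
    rw [← ENNReal.ofReal_mul hθ0, ← ENNReal.ofReal_add (by positivity) (by positivity)]
    refine ENNReal.ofReal_le_ofReal ?_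
    have h1 : 2 * θ * (2 * σ * n * K ^ (2 * q)) ≤ K ^ 2 * (2 * σ * n * K ^ (2 * q)) := by gcongr
    have h2 : K ^ (2 * (q + 1)) = K ^ 2 * K ^ (2 * q) := by ring
    rw [h2]
    linarith

/-- Trace moment bound for the off-diagonal Gram matrix of independent vectors, restricted to
configurations with small off-diagonal entries. -/
theorem setLIntegral_trace_pow_le [IsProbabilityMeasure ν] {σ β θ K : ℝ} (hφ : Measurable φ)
    (hσ0 : 0 ≤ σ)
    (hσ : ∀ y : κ → ℝ, ∫⁻ x, ENNReal.ofReal ((y ⬝ᵥ φ x) ^ 2) ∂ν ≤ ENNReal.ofReal (σ * (y ⬝ᵥ y)))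
    (hK : 0 ≤ K) (hK1 : K ≤ 1) (hθK : 2 * θ ≤ K ^ 2) {M Q : ℕ}
    (hθ : 2 * Q * (M * β ^ 2) ≤ θ) (hσK : 4 * σ * M ≤ K ^ 2) (n : ℕ) (hn : n ≤ M)
    (q : ℕ) (hq : q ≤ Q) :
    ∫⁻ v in goodSet φ β n, ENNReal.ofReal (offGram φ v ^ (2 * q)).trace
      ∂(Measure.pi fun _ => ν) ≤ ENNReal.ofReal (n * K ^ (2 * q)) := by
  have hθ0 : 0 ≤ θ := le_trans (by positivity) hθ
  induction n generalizing q with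
  | zero => simp
  | succ n ih =>
    have ih' := ih (by lia)
    obtain rfl | ⟨q, rfl⟩ : q = 0 ∨ ∃ q', q = q' + 1 := by
      rcases q with _ | q
      · exact Or.inl rfl
      · exact Or.inr ⟨q, rfl⟩
    · simp only [mul_zero, pow_zero, trace_one, Fintype.card_fin, mul_one, lintegral_const]
      rw [Measure.restrict_apply_univ]
      exact (mul_le_mul_right prob_le_one _).trans_eq (mul_one _)
    have hdm : ∀ i, Measurable fun v : Fin (n + 1) → X =>
        ENNReal.ofReal ((offGram φ v ^ (2 * (q + 1))) i i) := fun i =>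
      (measurable_matrix_pow (measurable_offGram hφ) _ i i).ennreal_ofReal
    have hdiag : ∀ i, ∫⁻ v in goodSet φ β (n + 1),
        ENNReal.ofReal ((offGram φ v ^ (2 * (q + 1))) i i) ∂(Measure.pi fun _ => ν) ≤
        ENNReal.ofReal (4 * σ * n * K ^ (2 * q)) := by
      intro i
      refine le_trans ?_
        (setLIntegral_returnBound_le (Q := Q) hφ hσ0 hσ hθ0 hK hK1 hθK ih' hq)
      rw [← lintegral_indicator (measurableSet_goodSet hφ β _),
        ← lintegral_indicator (measurableSet_goodSet hφ β _),
        lintegral_pi_eq_lintegral_insertNth i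
          ((hdm i).indicator (measurableSet_goodSet hφ β _))]
      refine lintegral_mono fun v => ?_
      by_cases hv : v ∈ goodSet φ β n
      · rw [Set.indicator_of_mem hv]
        refine lintegral_mono fun x => ?_
        by_cases hx : (i.insertNth x v : Fin (n + 1) → X) ∈ goodSet φ β (n + 1)
        · rw [Set.indicator_of_mem hx]
          refine ENNReal.ofReal_le_ofReal ?_
          have h := pow_apply_self_le_returnBound
            (offGram_isSymm (φ := φ) (i.insertNth x v : Fin (n + 1) → X)) i
            (offGram_apply_self _ i) (row_dotProduct_self_le hx i)
            (q := q + 1) (θ := θ) (by lia) ?_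
          · simpa only [offGram_insertNth_submatrix, offGram_insertNth_row] using h
          · refine le_trans ?_ hθ
            push_cast
            have h1 : ((q : ℝ) + 1) ≤ Q := by exact_mod_cast hq
            have h2 : (n : ℝ) ≤ M := by exact_mod_cast (by lia : n ≤ M)
            gcongr
        · rw [Set.indicator_of_notMem hx]
          exact zero_le
      · have : ∀ x, (i.insertNth x v : Fin (n + 1) → X) ∉ goodSet φ β (n + 1) := fun x hx =>
          hv (goodSet_of_insertNth hx)
        simp [Set.indicator_of_notMem, this]
    calc _ = ∑ i, ∫⁻ v in goodSet φ β (n + 1),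
          ENNReal.ofReal ((offGram φ v ^ (2 * (q + 1))) i i) ∂(Measure.pi fun _ => ν) := by
          rw [← lintegral_finsetSum _ fun i _ => hdm i]
          refine lintegral_congr fun v => ?_
          exact ENNReal.ofReal_sum_of_nonneg fun i _ =>
            trace_even_pow_nonneg (offGram_isSymm v) _ i
      _ ≤ ∑ i : Fin (n + 1), ENNReal.ofReal (4 * σ * n * K ^ (2 * q)) :=
          Finset.sum_le_sum fun i _ => hdiag i
      _ = ENNReal.ofReal ((n + 1 : ℕ) * (4 * σ * n * K ^ (2 * q))) := by
          rw [Finset.sum_const, Finset.card_univ, Fintype.card_fin, nsmul_eq_mul,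
            ENNReal.ofReal_mul (p := ((n + 1 : ℕ) : ℝ)) (by positivity), ENNReal.ofReal_natCast]
      _ ≤ _ := by
          refine ENNReal.ofReal_le_ofReal (mul_le_mul_of_nonneg_left ?_ (by positivity))
          have h2 : (n : ℝ) ≤ M := by exact_mod_cast (by lia : n ≤ M)
          calc 4 * σ * n * K ^ (2 * q) ≤ 4 * σ * M * K ^ (2 * q) := by gcongr
            _ ≤ K ^ 2 * K ^ (2 * q) := by gcongr
            _ = K ^ (2 * (q + 1)) := by ring

end Moments

section Sphere

variable {d : ℕ}

lemma uniformSphere_apply [NeZero d] {s : Set (EuclideanSpace ℝ (Fin d))} (hs : MeasurableSet s) :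
    uniformSphere d s = volume (Set.Ioo (0 : ℝ) 1 • (sphere 0 1 ∩ s)) /
      volume (ball (0 : EuclideanSpace ℝ (Fin d)) 1) := by
  have hd : (d : ENNReal) ≠ 0 := by simp [NeZero.ne d]
  rw [uniformSphere, Measure.smul_apply, Measure.map_apply measurable_subtype_coe hs,
    Measure.toSphere_apply' _ (measurable_subtype_coe hs), Measure.toSphere_apply_univ,
    Subtype.image_preimage_coe, smul_eq_mul, finrank_euclideanSpace_fin, mul_comm,
    ← ENNReal.div_eq_inv_mul.trans (mul_comm _ _),
    ENNReal.mul_div_mul_left _ _ hd (ENNReal.natCast_ne_top d)]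

instance isProbabilityMeasure_uniformSphere [NeZero d] :
    IsProbabilityMeasure (uniformSphere d) := by
  constructor
  rw [uniformSphere, Measure.smul_apply, Measure.map_apply measurable_subtype_coe .univ,
    Set.preimage_univ, smul_eq_mul]
  refine ENNReal.inv_mul_cancel ?_ (measure_ne_top _ _)
  rw [Ne, Measure.measure_univ_eq_zero]
  exact Measure.toSphere_ne_zero _

lemma ae_norm_eq_one_uniformSphere : ∀ᵐ v ∂uniformSphere d, ‖v‖ = 1 := by
  refine Measure.ae_smul_measure ?_ _
  rw [ae_map_iff measurable_subtype_coe.aemeasurable (measurableSet_eq_fun measurable_norm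
    measurable_const)]
  exact Filter.Eventually.of_forall fun v => by simp

lemma measurePreserving_uniformSphere [NeZero d]
    (e : EuclideanSpace ℝ (Fin d) ≃ₗᵢ[ℝ] EuclideanSpace ℝ (Fin d)) :
    MeasurePreserving e (uniformSphere d) (uniformSphere d) := by
  have he : Measurable e := e.continuous.measurable
  refine ⟨he, Measure.ext fun s hs => ?_⟩
  rw [Measure.map_apply he hs, uniformSphere_apply (he hs), uniformSphere_apply hs]
  congr 1
  have h : Set.Ioo (0 : ℝ) 1 • (sphere 0 1 ∩ e ⁻¹' s) =
      e ⁻¹' (Set.Ioo (0 : ℝ) 1 • (sphere 0 1 ∩ s)) := by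
    ext x
    simp only [Set.mem_smul, Set.mem_preimage]
    constructor
    · rintro ⟨r, hr, y, ⟨hy1, hy2⟩, rfl⟩
      exact ⟨r, hr, e y, ⟨by simpa using hy1, hy2⟩, by simp⟩
    · rintro ⟨r, hr, y, ⟨hy1, hy2⟩, h⟩
      refine ⟨r, hr, e.symm y, ⟨by simpa using hy1, by simpa using hy2⟩, ?_⟩
      apply e.injective
      simpa using h
  rw [h]
  exact e.measurePreserving.measure_preimage_emb e.toHomeomorph.measurableEmbedding _

lemma uniformSphere_cap_le [NeZero d] {u : EuclideanSpace ℝ (Fin d)} (hu : ‖u‖ ≤ 1) {ε : ℝ}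
    (hε : 0 < ε) (hε2 : ε ^ 2 ≤ 1 / 2) :
    uniformSphere d {v | ε < ⟪v, u⟫} ≤ ENNReal.ofReal (Real.exp (-(d * ε ^ 2 / 2))) := by
  have hs : MeasurableSet {v : EuclideanSpace ℝ (Fin d) | ε < ⟪v, u⟫} :=
    measurableSet_lt measurable_const (by fun_prop)
  rw [uniformSphere_apply hs]
  have hb0 : volume (ball (0 : EuclideanSpace ℝ (Fin d)) 1) ≠ 0 :=
    (measure_ball_pos _ _ one_pos).ne'
  refine ENNReal.div_le_of_le_mul ?_
  have hsub : Set.Ioo (0 : ℝ) 1 • (sphere 0 1 ∩ {v : EuclideanSpace ℝ (Fin d) | ε < ⟪v, u⟫}) ⊆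
      closedBall (ε • u) (Real.exp (-(ε ^ 2 / 2))) := by
    rintro _ ⟨r, ⟨hr0, hr1⟩, v, ⟨hv, hvu⟩, rfl⟩
    have hv1 : ‖v‖ = 1 := by simpa using hv
    have hvu' : ε < ⟪v, u⟫ := hvu
    rw [mem_closedBall, dist_eq_norm]
    refine le_of_sq_le_sq ?_ (Real.exp_pos _).le
    have h1 : 1 - ε ^ 2 ≤ Real.exp (-(ε ^ 2 / 2)) ^ 2 := by
      rw [← Real.exp_nat_mul]
      have := Real.add_one_le_exp (-ε ^ 2)
      convert (by linarith : 1 - ε ^ 2 ≤ Real.exp (-ε ^ 2)) using 2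
      push_cast
      ring
    refine le_trans ?_ h1
    simp only [norm_sub_sq_real, norm_smul, real_inner_smul_left, real_inner_smul_right, hv1,
      Real.norm_eq_abs, abs_of_pos hr0, abs_of_pos hε, mul_one]
    have h2 : r * ε * ε ≤ r * ε * ⟪v, u⟫ := by gcongr
    have h3 : (ε * ‖u‖) ^ 2 ≤ ε ^ 2 := by
      rw [mul_pow]
      exact mul_le_of_le_one_right (sq_nonneg _) (pow_le_one₀ (norm_nonneg _) hu)
    nlinarith [mul_nonneg (sub_nonneg.2 hr1.le) (by linarith : 0 ≤ r + 1 - 2 * ε ^ 2)]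
  refine (measure_mono hsub).trans_eq ?_
  rw [Measure.addHaar_closedBall _ _ (Real.exp_pos _).le, finrank_euclideanSpace_fin,
    ← Real.exp_nat_mul]
  congr 3
  ring

lemma uniformSphere_inner_sq_gt_le [NeZero d] {u : EuclideanSpace ℝ (Fin d)} (hu : ‖u‖ ≤ 1) {t : ℝ}
    (ht : 0 < t) (ht2 : t ≤ 1 / 2) :
    uniformSphere d {v | t < ⟪v, u⟫ ^ 2} ≤ ENNReal.ofReal (2 * Real.exp (-(d * t / 2))) := by
  have hsq : √t ^ 2 = t := Real.sq_sqrt ht.le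
  have h1 := uniformSphere_cap_le hu (Real.sqrt_pos.2 ht) (by rwa [hsq])
  have h2 := uniformSphere_cap_le (u := -u) (by rwa [norm_neg]) (Real.sqrt_pos.2 ht) (by rwa [hsq])
  rw [hsq] at h1 h2
  have hsub : {v : EuclideanSpace ℝ (Fin d) | t < ⟪v, u⟫ ^ 2} ⊆
      {v | √t < ⟪v, u⟫} ∪ {v | √t < ⟪v, -u⟫} := by
    intro v hv
    have : √t < |⟪v, u⟫| := Real.lt_sqrt_of_sq_lt (by rwa [hsq]) |>.trans_eq (Real.sqrt_sq_eq_abs _)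
    simpa [lt_abs] using this
  refine (measure_mono hsub).trans ((measure_union_le _ _).trans ((add_le_add h1 h2).trans_eq ?_))
  rw [← ENNReal.ofReal_add (by positivity) (by positivity), two_mul]

lemma uniformSphere_coord_sq_gt_le [NeZero d] (k : Fin d) {t : ℝ}
    (ht : 0 < t) (ht2 : t ≤ 1 / 2) :
    uniformSphere d {v | t < v k ^ 2} ≤ ENNReal.ofReal (2 * Real.exp (-(d * t / 2))) := by
  have := uniformSphere_inner_sq_gt_le (u := EuclideanSpace.single k (1 : ℝ)) (by simp) ht ht2
  simpa only [EuclideanSpace.inner_single_right, one_mul, conj_trivial] using this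

end Sphere

lemma lintegral_dotProduct_sq_le {X κ : Type*} [Fintype κ] [MeasurableSpace X] {ν : Measure X}
    {φ : X → κ → ℝ} {σ : ℝ} (h2 : ∀ p, MemLp (fun x => φ x p) 2 ν)
    (horth : ∀ p p', p ≠ p' → ∫ x, φ x p * φ x p' ∂ν = 0)
    (hs : ∀ p, ∫ x, φ x p * φ x p ∂ν ≤ σ) (y : κ → ℝ) :
    ∫⁻ x, ENNReal.ofReal ((y ⬝ᵥ φ x) ^ 2) ∂ν ≤ ENNReal.ofReal (σ * (y ⬝ᵥ y)) := by
  have hint : ∀ p p', Integrable (fun x => φ x p * φ x p') ν := fun p p' =>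
    (h2 p).integrable_mul (h2 p')
  have hexp : (fun x => (y ⬝ᵥ φ x) ^ 2) =
      fun x => ∑ p, ∑ p', y p * y p' * (φ x p * φ x p') := by
    ext x
    simp only [sq, dotProduct, Finset.sum_mul_sum]
    exact Finset.sum_congr rfl fun p _ => Finset.sum_congr rfl fun p' _ => by ring
  have hint2 : ∀ p, Integrable (fun x => ∑ p', y p * y p' * (φ x p * φ x p')) ν := fun p =>
    integrable_finsetSum _ fun p' _ => (hint p p').const_mul _
  rw [← ofReal_integral_eq_lintegral_ofReal (by
    rw [hexp]; exact integrable_finsetSum _ fun p _ => hint2 p)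
    (Filter.Eventually.of_forall fun x => sq_nonneg _), hexp,
    integral_finsetSum _ fun p _ => hint2 p]
  refine ENNReal.ofReal_le_ofReal ?_
  rw [dotProduct, Finset.mul_sum]
  refine Finset.sum_le_sum fun p _ => ?_
  rw [integral_finsetSum _ fun p' _ => (hint p p').const_mul _,
    Finset.sum_eq_single p (fun p' _ hp => by
      rw [integral_const_mul, horth p p' hp.symm, mul_zero]) (by simp), integral_const_mul]
  nlinarith [mul_le_mul_of_nonneg_left (hs p) (mul_self_nonneg (y p))]

section PairFeature

variable {d : ℕ}

/-- The vector of products `√2 v_k v_l` over pairs `k < l`, extended by zero to all pairs. -/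
noncomputable def pairFeature (v : EuclideanSpace ℝ (Fin d)) (p : Fin d × Fin d) : ℝ :=
  if p.1 < p.2 then √2 * (v p.1 * v p.2) else 0

lemma measurable_pairFeature : Measurable (pairFeature (d := d)) := by
  refine measurable_pi_iff.2 fun p => ?_
  unfold pairFeature
  split_ifs
  · fun_prop
  · exact measurable_const

lemma pairFeature_dotProduct (x y : EuclideanSpace ℝ (Fin d)) :
    pairFeature x ⬝ᵥ pairFeature y =
      2 * ∑ l : Fin d, ∑ k ∈ Finset.Iio l, x k * x l * (y k * y l) := by
  rw [dotProduct, Fintype.sum_prod_type_right, Finset.mul_sum]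
  refine Finset.sum_congr rfl fun l _ => ?_
  rw [Finset.mul_sum, ← Finset.filter_gt_eq_Iio, Finset.sum_filter]
  refine Finset.sum_congr rfl fun k _ => ?_
  simp only [pairFeature]
  split_ifs
  · linear_combination x k * x l * (y k * y l) * Real.mul_self_sqrt (zero_le_two (α := ℝ))
  · exact mul_zero 0

lemma pairFeature_dotProduct_eq_inner (x y : EuclideanSpace ℝ (Fin d)) :
    pairFeature x ⬝ᵥ pairFeature y = ⟪x, y⟫ ^ 2 - ∑ k, x k ^ 2 * y k ^ 2 := by
  have h1 : ⟪x, y⟫ ^ 2 = ∑ l, ∑ k, x k * x l * (y k * y l) := by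
    rw [PiLp.inner_apply, sq, Finset.sum_mul_sum]
    refine Finset.sum_congr rfl fun l _ => Finset.sum_congr rfl fun k _ => ?_
    simp only [RCLike.inner_apply, conj_trivial]
    ring
  have h2 : ∑ l, ∑ k ∈ Finset.Iio l, x k * x l * (y k * y l) =
      ∑ l, ∑ k ∈ Finset.Ioi l, x k * x l * (y k * y l) := by
    simp only [← Finset.filter_gt_eq_Iio, ← Finset.filter_lt_eq_Ioi, Finset.sum_filter]
    rw [Finset.sum_comm]
    refine Finset.sum_congr rfl fun l _ => Finset.sum_congr rfl fun k _ => ?_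
    congr 1
    ring
  have h3 : ∀ l : Fin d, ∑ k, x k * x l * (y k * y l) =
      ∑ k ∈ Finset.Iio l, x k * x l * (y k * y l) + x l ^ 2 * y l ^ 2 +
      ∑ k ∈ Finset.Ioi l, x k * x l * (y k * y l) := by
    intro l
    have hs : x l ^ 2 * y l ^ 2 = ∑ k, if k = l then x k * x l * (y k * y l) else 0 := by
      simp only [Finset.sum_ite_eq', Finset.mem_univ, if_true]
      ring
    rw [hs, ← Finset.filter_gt_eq_Iio, ← Finset.filter_lt_eq_Ioi, Finset.sum_filter,
      Finset.sum_filter, ← Finset.sum_add_distrib, ← Finset.sum_add_distrib]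
    refine Finset.sum_congr rfl fun k _ => ?_
    rcases lt_trichotomy k l with h | rfl | h
    · simp [h, h.ne, h.not_gt]
    · simp
    · simp [h, h.ne', h.not_gt]
  rw [pairFeature_dotProduct, h1, Finset.sum_congr rfl fun l _ => h3 l, Finset.sum_add_distrib,
    Finset.sum_add_distrib, ← h2]
  ring

lemma sum_sq_eq_one {v : EuclideanSpace ℝ (Fin d)} (hv : ‖v‖ = 1) : ∑ k, v k ^ 2 = 1 := by
  rw [← EuclideanSpace.real_norm_sq_eq, hv, one_pow]

lemma sq_coord_le_one {v : EuclideanSpace ℝ (Fin d)} (hv : ‖v‖ = 1) (k : Fin d) :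
    v k ^ 2 ≤ 1 :=
  (Finset.single_le_sum (f := fun k => v k ^ 2) (fun _ _ => sq_nonneg _)
    (Finset.mem_univ k)).trans_eq (sum_sq_eq_one hv)

lemma mem_goodSet_pairFeature {m : ℕ} {t : ℝ} (ht : 0 ≤ t) {v : Fin m → EuclideanSpace ℝ (Fin d)}
    (hv : ∀ i, ‖v i‖ = 1) (hc : ∀ i k, v i k ^ 2 ≤ t) (hp : ∀ i j, i ≠ j → ⟪v i, v j⟫ ^ 2 ≤ t) :
    v ∈ goodSet pairFeature t m := by
  refine ⟨fun i => ?_, fun i j => ?_⟩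
  · rw [pairFeature_dotProduct_eq_inner, real_inner_self_eq_norm_sq, hv]
    have : 0 ≤ ∑ k, v i k ^ 2 * v i k ^ 2 := by positivity
    linarith
  · simp only [offGram, Matrix.of_apply]
    split_ifs with hij
    · simpa using ht
    · rw [pairFeature_dotProduct_eq_inner]
      refine abs_sub_le_of_nonneg_of_le (sq_nonneg _) (hp i j hij) (by positivity) ?_
      calc ∑ k, v i k ^ 2 * v j k ^ 2 ≤ ∑ k, t * v j k ^ 2 := by
            gcongr with k
            exact hc i k
        _ = t := by rw [← Finset.mul_sum, sum_sq_eq_one (hv j), mul_one]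

lemma memLp_uniformSphere [NeZero d] {f : EuclideanSpace ℝ (Fin d) → ℝ} (hf : Measurable f) {C : ℝ}
    (hC : ∀ v, ‖v‖ = 1 → |f v| ≤ C) {p : ENNReal} : MemLp f p (uniformSphere d) :=
  .of_bound hf.aestronglyMeasurable C (ae_norm_eq_one_uniformSphere.mono hC)

lemma abs_pairFeature_le {v : EuclideanSpace ℝ (Fin d)} (hv : ‖v‖ = 1) (p : Fin d × Fin d) :
    |pairFeature v p| ≤ √2 := by
  unfold pairFeature
  split_ifs
  · rw [abs_mul, abs_mul, abs_of_nonneg (Real.sqrt_nonneg _)]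
    refine mul_le_of_le_one_right (Real.sqrt_nonneg _) (mul_le_one₀ ?_ (abs_nonneg _) ?_) <;>
    exact abs_le_one_iff_mul_self_le_one.2 (by rw [← sq]; exact sq_coord_le_one hv _)
  · simp

/-- The isometry negating the `k`-th coordinate. -/
noncomputable def flipCoord (k : Fin d) :
    EuclideanSpace ℝ (Fin d) ≃ₗᵢ[ℝ] EuclideanSpace ℝ (Fin d) :=
  LinearIsometryEquiv.piLpCongrRight 2 fun i =>
    if i = k then LinearIsometryEquiv.neg ℝ else LinearIsometryEquiv.refl ℝ ℝ

lemma flipCoord_apply (k i : Fin d) (v : EuclideanSpace ℝ (Fin d)) :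
    flipCoord k v i = if i = k then -v i else v i := by
  simp only [flipCoord, LinearIsometryEquiv.piLpCongrRight_apply]
  split_ifs <;> rfl

lemma integral_pairFeature_mul [NeZero d] {p p' : Fin d × Fin d} (h : p ≠ p') :
    ∫ v, pairFeature v p * pairFeature v p' ∂uniformSphere d = 0 := by
  by_cases hp : p.1 < p.2
  swap
  · simp [pairFeature, hp]
  by_cases hp' : p'.1 < p'.2
  swap
  · simp [pairFeature, hp']
  obtain ⟨k, hk, hk1, hk2⟩ : ∃ k, (k = p.1 ∨ k = p.2) ∧ p'.1 ≠ k ∧ p'.2 ≠ k := by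
    by_contra! hcon
    have h1 := hcon p.1 (Or.inl rfl)
    have h2 := hcon p.2 (Or.inr rfl)
    refine h (Prod.ext ?_ ?_) <;> grind
  have hflip : ∀ v, pairFeature (flipCoord k v) p * pairFeature (flipCoord k v) p' =
      -(pairFeature v p * pairFeature v p') := by
    intro v
    have h1 : flipCoord k v p.1 * flipCoord k v p.2 = -(v p.1 * v p.2) := by
      rcases hk with rfl | rfl
      · simp [flipCoord_apply, hp.ne']
      · simp [flipCoord_apply, hp.ne]
    have h2 : flipCoord k v p'.1 * flipCoord k v p'.2 = v p'.1 * v p'.2 := by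
      simp [flipCoord_apply, hk1, hk2]
    simp only [pairFeature, hp, hp', if_true, h1, h2]
    ring
  have := (measurePreserving_uniformSphere (flipCoord k)).integral_comp
    (flipCoord k).toHomeomorph.measurableEmbedding
    fun v => pairFeature v p * pairFeature v p'
  simp only [hflip, integral_neg] at this
  linarith

lemma integral_coord_pow_four_le [NeZero d] (k : Fin d) {t : ℝ} (ht : 0 < t) (ht2 : t ≤ 1 / 2) :
    ∫ v, v k ^ 4 ∂uniformSphere d ≤ t ^ 2 + 2 * Real.exp (-(d * t / 2)) := by
  have hm : MeasurableSet {v : EuclideanSpace ℝ (Fin d) | t < v k ^ 2} :=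
    measurableSet_lt measurable_const (by fun_prop)
  have hle : ∀ᵐ v ∂uniformSphere d, v k ^ 4 ≤
      t ^ 2 + {v : EuclideanSpace ℝ (Fin d) | t < v k ^ 2}.indicator (fun _ => (1 : ℝ)) v := by
    filter_upwards [ae_norm_eq_one_uniformSphere] with v hv
    have h0 := sq_nonneg (v k)
    have h1 := sq_coord_le_one hv k
    by_cases hk : t < v k ^ 2
    · rw [Set.indicator_of_mem (by exact hk)]
      nlinarith
    · rw [Set.indicator_of_notMem (by exact hk)]
      nlinarith [not_lt.1 hk]
  have hind := (integrable_const (μ := uniformSphere d) (1 : ℝ)).indicator hm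
  refine (integral_mono_of_nonneg
    (Filter.Eventually.of_forall fun v => (by decide : Even 4).pow_nonneg _)
    ((integrable_const _).add hind) hle).trans ?_
  rw [integral_add' (integrable_const _) hind, integral_indicator hm]
  simp only [integral_const, smul_eq_mul, probReal_univ, one_mul, mul_one,
    measureReal_restrict_apply_univ]
  gcongr
  exact ENNReal.toReal_le_of_le_ofReal (by positivity) (uniformSphere_coord_sq_gt_le k ht ht2)

lemma integral_pairFeature_sq_le [NeZero d] (p : Fin d × Fin d) {t : ℝ} (ht : 0 < t)
    (ht2 : t ≤ 1 / 2) : ∫ v, pairFeature v p * pairFeature v p ∂uniformSphere d ≤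
      2 * (t ^ 2 + 2 * Real.exp (-(d * t / 2))) := by
  have hint : ∀ k : Fin d, Integrable (fun v => v k ^ 4) (uniformSphere d) := fun k =>
    memLp_one_iff_integrable.1 <| memLp_uniformSphere (by fun_prop) (C := 1) fun v hv => by
      rw [abs_of_nonneg (by positivity), show v k ^ 4 = (v k ^ 2) ^ 2 by ring]
      exact pow_le_one₀ (sq_nonneg _) (sq_coord_le_one hv k)
  calc _ ≤ ∫ v, (v p.1 ^ 4 + v p.2 ^ 4) ∂uniformSphere d := by
        refine integral_mono_of_nonneg (Filter.Eventually.of_forall fun v => mul_self_nonneg _)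
          ((hint _).add (hint _)) (Filter.Eventually.of_forall fun v => ?_)
        simp only [pairFeature]
        split_ifs
        · nlinarith [sq_nonneg (v p.1 ^ 2 - v p.2 ^ 2), Real.mul_self_sqrt (zero_le_two (α := ℝ))]
        · rw [mul_zero]
          positivity
    _ ≤ _ := by
        rw [integral_add (hint _) (hint _), two_mul]
        exact add_le_add (integral_coord_pow_four_le _ ht ht2) (integral_coord_pow_four_le _ ht ht2)

lemma lintegral_dotProduct_pairFeature_sq_le [NeZero d] {t : ℝ} (ht : 0 < t) (ht2 : t ≤ 1 / 2)
    (y : Fin d × Fin d → ℝ) :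
    ∫⁻ v, ENNReal.ofReal ((y ⬝ᵥ pairFeature v) ^ 2) ∂uniformSphere d ≤
      ENNReal.ofReal (2 * (t ^ 2 + 2 * Real.exp (-(d * t / 2))) * (y ⬝ᵥ y)) :=
  lintegral_dotProduct_sq_le
    (fun p => memLp_uniformSphere ((measurable_pi_apply p).comp measurable_pairFeature)
      fun _ hv => abs_pairFeature_le hv p)
    (fun _ _ => integral_pairFeature_mul) (fun p => integral_pairFeature_sq_le p ht ht2) y

end PairFeature

section Main

variable {d m : ℕ}

lemma pi_uniformSphere_inner_sq_gt_le [NeZero d] {t : ℝ} (ht : 0 < t) (ht2 : t ≤ 1 / 2)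
    {i j : Fin m} (hij : i ≠ j) :
    (Measure.pi fun _ : Fin m => uniformSphere d) {v | ‖v j‖ ≤ 1 ∧ t < ⟪v i, v j⟫ ^ 2} ≤
      ENNReal.ofReal (2 * Real.exp (-(d * t / 2))) := by
  obtain _ | n := m
  · exact i.elim0
  obtain ⟨j, rfl⟩ := Fin.exists_succAbove_eq hij.symm
  have hs : MeasurableSet {v : Fin (n + 1) → EuclideanSpace ℝ (Fin d) |
      ‖v (i.succAbove j)‖ ≤ 1 ∧ t < ⟪v i, v (i.succAbove j)⟫ ^ 2} := by
    rw [Set.ofPred_and]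
    exact (measurableSet_le (by fun_prop) measurable_const).inter
      (measurableSet_lt measurable_const (by fun_prop))
  rw [← lintegral_indicator_one hs,
    lintegral_pi_eq_lintegral_insertNth i (measurable_one.indicator hs)]
  refine (lintegral_mono (g := fun _ => ENNReal.ofReal (2 * Real.exp (-(d * t / 2))))
    fun v => ?_).trans (by simp)
  by_cases hv : ‖v j‖ ≤ 1
  · refine le_trans ?_ (uniformSphere_inner_sq_gt_le hv ht ht2)
    rw [← lintegral_indicator_one (measurableSet_lt measurable_const (by fun_prop))]
    refine lintegral_mono fun x => ?_
    simp [Set.indicator, hv]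
  · simp [Set.indicator, hv]

lemma pi_uniformSphere_compl_goodSet_le [NeZero d] {t : ℝ} (ht : 0 < t) (ht2 : t ≤ 1 / 2) :
    (Measure.pi fun _ : Fin m => uniformSphere d) (goodSet pairFeature t m)ᶜ ≤
      ENNReal.ofReal ((m * d + m * m) * (2 * Real.exp (-(d * t / 2)))) := by
  set μ := Measure.pi fun _ : Fin m => uniformSphere d
  set ε := ENNReal.ofReal (2 * Real.exp (-(d * t / 2)))
  have heval : ∀ i, MeasurePreserving (Function.eval i) μ (uniformSphere d) := fun i =>
    measurePreserving_eval _ i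
  have hnorm : ∀ᵐ v ∂μ, ∀ i, ‖v i‖ = 1 := ae_all_iff.2 fun i =>
    (heval i).quasiMeasurePreserving.ae ae_norm_eq_one_uniformSphere
  have hsub : (goodSet pairFeature t m)ᶜ ≤ᵐ[μ]
      ((⋃ p : Fin m × Fin d, {v | t < v p.1 p.2 ^ 2}) ∪
        ⋃ p : Fin m × Fin m, {v | p.1 ≠ p.2 ∧ ‖v p.2‖ ≤ 1 ∧ t < ⟪v p.1, v p.2⟫ ^ 2} : Set _) := by
    filter_upwards [hnorm] with v hv hbad
    by_contra hcon
    obtain ⟨h1, h2⟩ := not_or.1 hcon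
    rw [Set.mem_iUnion, not_exists] at h1 h2
    refine hbad (mem_goodSet_pairFeature ht.le hv (fun i k => not_lt.1 (h1 (i, k)))
      fun i j hij => not_lt.1 fun h => h2 (i, j) ⟨hij, (hv j).le, h⟩)
  refine (measure_mono_ae hsub).trans ((measure_union_le _ _).trans ?_)
  have h1 : ∀ p : Fin m × Fin d, μ {v | t < v p.1 p.2 ^ 2} ≤ ε := fun p => by
    have hm : MeasurableSet {v : EuclideanSpace ℝ (Fin d) | t < v p.2 ^ 2} :=
      measurableSet_lt measurable_const (by fun_prop)
    exact ((heval p.1).measure_preimage hm.nullMeasurableSet).trans_le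
      (uniformSphere_coord_sq_gt_le p.2 ht ht2)
  have h2 : ∀ p : Fin m × Fin m,
      μ {v | p.1 ≠ p.2 ∧ ‖v p.2‖ ≤ 1 ∧ t < ⟪v p.1, v p.2⟫ ^ 2} ≤ ε := fun p => by
    by_cases hp : p.1 = p.2
    · simp [hp]
    · exact (measure_mono fun v hv => hv.2).trans (pi_uniformSphere_inner_sq_gt_le ht ht2 hp)
  refine (add_le_add ((measure_iUnion_fintype_le _ _).trans (Finset.sum_le_sum fun p _ => h1 p))
    ((measure_iUnion_fintype_le _ _).trans (Finset.sum_le_sum fun p _ => h2 p))).trans_eq ?_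
  simp only [Finset.sum_const, Finset.card_univ, Fintype.card_prod, Fintype.card_fin,
    nsmul_eq_mul, ← add_mul, ε]
  rw [ENNReal.ofReal_mul (p := (m * d + m * m : ℝ)) (by positivity), ← ENNReal.ofReal_natCast,
    ← ENNReal.ofReal_natCast, ← ENNReal.ofReal_add (by positivity) (by positivity)]
  push_cast
  rfl

lemma opNorm_le_of_trace_pow_le {n : ℕ} {A : Matrix (Fin n) (Fin n) ℝ} (hA : A.IsSymm) {r : ℝ}
    (hr : 0 ≤ r) {p : ℕ} (hp : Even p) (hp0 : p ≠ 0) (h : (A ^ p).trace ≤ r ^ p) :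
    opNorm A ≤ r :=
  l2_opNorm_le_of_trace_pow_le (A := A) ((conjTranspose_eq_transpose_of_trivial A).trans hA) hr
    hp hp0 h

lemma pi_uniformSphere_opNorm_gt_le [NeZero d] {t : ℝ} (ht : 0 < t) (ht2 : t ≤ 1 / 2) {q : ℕ}
    (hq : q ≠ 0) (hqt : 2 * q * (m * t ^ 2) ≤ 1 / 128)
    (hσt : 8 * (t ^ 2 + 2 * Real.exp (-(d * t / 2))) * m ≤ 1 / 64) :
    (Measure.pi fun _ : Fin m => uniformSphere d)
      (goodSet pairFeature t m ∩ {v | 1 / 4 < opNorm (offGram pairFeature v)}) ≤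
      ENNReal.ofReal (m * (1 / 4) ^ q) := by
  set μ := Measure.pi fun _ : Fin m => uniformSphere d
  have hmom := setLIntegral_trace_pow_le (ν := uniformSphere d) (K := 1 / 8) (θ := 1 / 128)
    (M := m) (Q := q) measurable_pairFeature (by positivity)
    (lintegral_dotProduct_pairFeature_sq_le ht ht2) (by norm_num) (by norm_num) (by norm_num)
    hqt (by linarith) m le_rfl q le_rfl
  have hsub : goodSet pairFeature t m ∩
      {v : Fin m → EuclideanSpace ℝ (Fin d) | 1 / 4 < opNorm (offGram pairFeature v)} ⊆
      {v | ENNReal.ofReal ((1 / 4) ^ (2 * q)) ≤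
        ENNReal.ofReal (offGram pairFeature v ^ (2 * q)).trace} ∩ goodSet pairFeature t m := by
    rintro v ⟨hv, hop⟩
    refine ⟨ENNReal.ofReal_le_ofReal (le_of_not_ge fun h => ?_), hv⟩
    exact hop.not_ge (opNorm_le_of_trace_pow_le (offGram_isSymm v) (by norm_num)
      (even_two_mul q) (by lia) h)
  have hmeas : Measurable fun v : Fin m → EuclideanSpace ℝ (Fin d) =>
      ENNReal.ofReal (offGram pairFeature v ^ (2 * q)).trace :=
    (Finset.measurable_sum _ fun i _ =>
      measurable_matrix_pow (measurable_offGram measurable_pairFeature) _ i i).ennreal_ofReal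
  refine (measure_mono hsub).trans ?_
  have hmarkov := (mul_meas_ge_le_lintegral (μ := μ.restrict (goodSet pairFeature t m)) hmeas
    (ENNReal.ofReal ((1 / 4) ^ (2 * q)))).trans hmom
  rw [Measure.restrict_apply (measurableSet_le measurable_const hmeas), mul_comm] at hmarkov
  refine ((ENNReal.le_div_iff_mul_le (.inl (by positivity)) (.inl ENNReal.ofReal_ne_top)).2
    hmarkov).trans_eq ?_
  rw [← ENNReal.ofReal_div_of_pos (by positivity), mul_div_assoc, ← div_pow, pow_mul]
  norm_num

lemma sample_size_bounds {L D M : ℝ} (hL : 1 ≤ L) (hD : 0 < D)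
    (hM : M ≤ 1 / 10 ^ 7 * D ^ 2 / L ^ 4) :
    M ≤ D ^ 2 ∧ M * (20 * L / D) ^ 2 ≤ 1 / 20000 / L := by
  have hL0 : 0 < L := by linarith
  constructor
  · refine hM.trans ((div_le_self (by positivity) (one_le_pow₀ hL)).trans ?_)
    exact mul_le_of_le_one_left (sq_nonneg D) (by norm_num)
  · calc M * (20 * L / D) ^ 2 ≤ 1 / 10 ^ 7 * D ^ 2 / L ^ 4 * (20 * L / D) ^ 2 := by gcongr
      _ = 1 / 25000 / L / L := by field_simp; norm_num
      _ ≤ 1 / 25000 / L := div_le_self (by positivity) hL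
      _ ≤ 1 / 20000 / L := by gcongr; norm_num

lemma one_sub_le_pi_uniformSphere [NeZero d] (hL : 1 ≤ Real.log d) (hLd : 40 * Real.log d ≤ d)
    (hm : (m : ℝ) ≤ 1 / 10 ^ 7 * d ^ 2 / Real.log d ^ 4) :
    ENNReal.ofReal (1 - 1 / (d : ℝ)) ≤ (Measure.pi fun _ : Fin m => uniformSphere d)
      {v | opNorm (offGram pairFeature v) ≤ 1 / 4} := by
  set L := Real.log d
  set t : ℝ := 20 * L / d with htdef
  have hd40 : (40 : ℝ) ≤ d := by linarith
  have hd0 : (0 : ℝ) < d := by linarith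
  have ht : 0 < t := by positivity
  have ht2 : t ≤ 1 / 2 := by rw [htdef, div_le_iff₀ hd0]; linarith
  have hexp : ∀ n : ℕ, Real.exp (-(n * L)) = 1 / (d : ℝ) ^ n := fun n => by
    rw [Real.exp_neg, Real.exp_nat_mul, Real.exp_log hd0, one_div]
  have hdt : Real.exp (-(d * t / 2)) = 1 / (d : ℝ) ^ 10 := by
    rw [← hexp, htdef]
    congr 2
    push_cast
    field_simp
    norm_num
  obtain ⟨hmd, hmt⟩ := sample_size_bounds hL hd0 hm
  set q := ⌈5 * L⌉₊
  have hq5 : 5 * L ≤ q := Nat.le_ceil _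
  have hq6 : (q : ℝ) ≤ 6 * L := by
    linarith [Nat.ceil_lt_add_one (by positivity : 0 ≤ 5 * L)]
  have hq0 : q ≠ 0 := by
    have : (0 : ℝ) < q := by linarith
    exact_mod_cast this.ne'
  have hqt : 2 * q * (m * t ^ 2) ≤ 1 / 128 := by
    calc 2 * q * (m * t ^ 2) ≤ 2 * (6 * L) * (1 / 20000 / L) := by gcongr
      _ ≤ 1 / 128 := by field_simp; norm_num
  have hσt : 8 * (t ^ 2 + 2 * Real.exp (-(d * t / 2))) * m ≤ 1 / 64 := by
    have h1 : m * t ^ 2 ≤ 1 / 20000 := hmt.trans (div_le_self (by norm_num) hL)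
    have h2 : m * (1 / (d : ℝ) ^ 10) ≤ 1 / 40 ^ 8 := by
      calc m * (1 / (d : ℝ) ^ 10) ≤ d ^ 2 * (1 / (d : ℝ) ^ 10) := by gcongr
        _ = 1 / (d : ℝ) ^ 8 := by field_simp
        _ ≤ 1 / 40 ^ 8 := by gcongr
    rw [hdt]
    linarith
  have hbad := pi_uniformSphere_compl_goodSet_le (d := d) (m := m) ht ht2
  have hop := pi_uniformSphere_opNorm_gt_le (d := d) (m := m) ht ht2 hq0 hqt hσt
  set μ := Measure.pi fun _ : Fin m => uniformSphere d
  set S := {v : Fin m → EuclideanSpace ℝ (Fin d) | opNorm (offGram pairFeature v) ≤ 1 / 4}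
  have hquarter : (1 / 4 : ℝ) ^ q ≤ 1 / (d : ℝ) ^ 5 := by
    rw [← hexp 5]
    calc (1 / 4 : ℝ) ^ q ≤ Real.exp (-1) ^ q := by
          gcongr
          linarith [Real.exp_neg_one_gt_d9]
      _ = Real.exp (-q) := by rw [← Real.exp_nat_mul, mul_neg_one]
      _ ≤ _ := by
          rw [Real.exp_le_exp]
          push_cast
          linarith
  have hSc : μ Sᶜ ≤ ENNReal.ofReal (1 / d) := by
    have hsub : Sᶜ ⊆ (goodSet pairFeature t m ∩ {v | 1 / 4 < opNorm (offGram pairFeature v)}) ∪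
        (goodSet pairFeature t m)ᶜ := fun v hv => by
      by_cases hg : v ∈ goodSet pairFeature t m
      · exact Or.inl ⟨hg, by simpa [S] using hv⟩
      · exact Or.inr hg
    refine (measure_mono hsub).trans ((measure_union_le _ _).trans
      ((add_le_add hop hbad).trans ?_))
    rw [← ENNReal.ofReal_add (by positivity) (by positivity), hdt]
    refine ENNReal.ofReal_le_ofReal ?_
    have hd1 : (d : ℝ) ≤ d ^ 2 := by nlinarith
    calc (m : ℝ) * (1 / 4) ^ q + (m * d + m * m) * (2 * (1 / (d : ℝ) ^ 10)) ≤
          (d : ℝ) ^ 2 * (1 / (d : ℝ) ^ 5) +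
            (d ^ 2 * d ^ 2 + d ^ 2 * d ^ 2) * (2 * (1 / (d : ℝ) ^ 10)) := by
            gcongr
      _ = (1 / (d : ℝ) ^ 2 + 4 / d ^ 5) * (1 / d) := by field_simp; norm_num
      _ ≤ (1 / 40 ^ 2 + 4 / 40 ^ 5) * (1 / d) := by gcongr
      _ ≤ 1 / d := mul_le_of_le_one_left (by positivity) (by norm_num)
  have huniv : 1 ≤ μ S + μ Sᶜ := by
    rw [← measure_univ (μ := μ), ← Set.union_compl_self S]
    exact measure_union_le _ _
  rw [ENNReal.ofReal_sub _ (by positivity), ENNReal.ofReal_one, tsub_le_iff_right]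
  exact huniv.trans (add_le_add_right hSc _)

end Main

end OffDiagonalGram

/-- There are `c > 0` and `d₀` such that for all `d ≥ d₀` and positive `m ≤ c·d²/log⁴(d)`:
if `v⁽¹⁾,…,v⁽ᵐ⁾` are i.i.d. uniform on the sphere and `A′` has zero diagonal and off-diagonal
entries `A′_{ij} = 2·Σ_{k<ℓ} v⁽ⁱ⁾_k v⁽ⁱ⁾_ℓ v⁽ʲ⁾_k v⁽ʲ⁾_ℓ`, then `Pr(‖A′‖₂ ≤ 1/4) ≥ 1 − 1/d`. -/
theorem A_prime_norm_bound :
    ∃ c : ℝ, 0 < c ∧ ∃ d₀ : ℕ, ∀ d : ℕ, d₀ ≤ d → ∀ m : ℕ,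
      1 ≤ m → (m : ℝ) ≤ c * d ^ 2 / (Real.log d) ^ 4 →
      ENNReal.ofReal (1 - 1 / (d : ℝ)) ≤
        (Measure.pi fun _ : Fin m => uniformSphere d)
          {v : Fin m → EuclideanSpace ℝ (Fin d) |
            opNorm
              (Matrix.of fun i j : Fin m =>
                if i = j then 0
                else 2 * ∑ l : Fin d, ∑ k ∈ Finset.Iio l,
                  v i k * v i l * (v j k * v j l))
              ≤ 1 / 4} := by
  refine ⟨1 / 10 ^ 7, by norm_num, 6400, fun d hd m _ hm => ?_⟩
  have hd' : (6400 : ℝ) ≤ d := by exact_mod_cast hd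
  have : NeZero d := ⟨by lia⟩
  have hL : 1 ≤ Real.log d := by
    rw [Real.le_log_iff_exp_le (by linarith)]
    linarith [Real.exp_one_lt_d9]
  have hLd : 40 * Real.log d ≤ d := by
    have h1 : Real.log d = 2 * Real.log √d := by rw [Real.log_sqrt (by linarith)]; ring
    have h2 := Real.log_le_self (Real.sqrt_nonneg d)
    have h3 : 80 ≤ √(d : ℝ) := Real.le_sqrt_of_sq_le (by linarith)
    nlinarith [Real.mul_self_sqrt (by linarith : (0 : ℝ) ≤ d)]
  have h := one_sub_le_pi_uniformSphere hL hLd hm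
  simp only [offGram, pairFeature_dotProduct] at h
  exact h
end

section
/- There exist constants C > 0, c > 0, and d₀ such that for all d ≥ d₀, all positive integers m ≤ d², and every fixed unit vector u ∈ ℝ^d the following holds: if v⁽¹⁾, …, v⁽ᵐ⁾ are i.i.d. uniformly random points on the unit sphere S^{d−1} ⊆ ℝ^d, then Pr( Σ_{i=1}^m min( (u·v⁽ⁱ⁾)⁴, d^{−1/2} ) > C·m/d² ) ≤ exp( −c·m/d^{7/8} ). -/
open MeasureTheory Metric ProbabilityTheory

open scoped ENNReal

section Polar

variable {E : Type*} [NormedAddCommGroup E] [NormedSpace ℝ E] [Nontrivial E]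
  [FiniteDimensional ℝ E] [MeasurableSpace E] [BorelSpace E]

/-- Integration in polar coordinates with respect to an additive Haar measure. -/
lemma lintegral_eq_lintegral_toSphere_Ioi (μ : Measure E) [μ.IsAddHaarMeasure]
    {f : E → ℝ≥0∞} (hf : Measurable f) :
    ∫⁻ x, f x ∂μ = ∫⁻ v, ∫⁻ r in Set.Ioi (0 : ℝ),
      ENNReal.ofReal (r ^ (Module.finrank ℝ E - 1)) * f (r • (v : E)) ∂volume ∂μ.toSphere := by
  have hmp := μ.measurePreserving_homeomorphUnitSphereProd
  calc
    ∫⁻ x, f x ∂μ = ∫⁻ x : ({(0)}ᶜ : Set E), f x ∂(μ.comap (↑)) := by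
      rw [lintegral_subtype_comap (measurableSet_singleton _).compl f, restrict_compl_singleton]
    _ = ∫⁻ p, f (p.2.1 • (p.1 : E))
          ∂μ.toSphere.prod (.volumeIoiPow (Module.finrank ℝ E - 1)) := by
      rw [← hmp.lintegral_comp_emb (Homeomorph.measurableEmbedding _)]
      refine lintegral_congr fun x ↦ ?_
      have hx : ‖(x : E)‖ ≠ 0 := norm_ne_zero_iff.2 x.2
      simp [smul_smul, hx]
    _ = ∫⁻ v, ∫⁻ r : Set.Ioi (0 : ℝ), f (r.1 • (v : E))
          ∂.volumeIoiPow (Module.finrank ℝ E - 1) ∂μ.toSphere :=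
      lintegral_prod _ (by fun_prop)
    _ = _ := by
      refine lintegral_congr fun v ↦ ?_
      rw [Measure.volumeIoiPow, lintegral_withDensity_eq_lintegral_mul _ (by fun_prop)
        (by fun_prop)]
      exact lintegral_subtype_comap measurableSet_Ioi
        fun r : ℝ ↦ ENNReal.ofReal (r ^ (Module.finrank ℝ E - 1)) * f (r • (v : E))

end Polar

lemma lintegral_Ioi_pow_mul_exp_neg_mul_sq {n : ℕ} (hn : 0 < n) {b : ℝ} (hb : 0 < b) :
    ∫⁻ r in Set.Ioi (0 : ℝ), ENNReal.ofReal (r ^ (n - 1)) * ENNReal.ofReal (Real.exp (-b * r ^ 2)) =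
      ENNReal.ofReal (b ^ (-(n : ℝ) / 2) * (1 / 2) * Real.Gamma (n / 2)) := by
  have hq : (-1 : ℝ) < (n : ℝ) - 1 := by
    have : (0 : ℝ) < n := by exact_mod_cast hn
    linarith
  have hI := integral_rpow_mul_exp_neg_mul_rpow (p := 2) two_pos hq hb
  rw [sub_add_cancel] at hI
  rw [← hI, ofReal_integral_eq_lintegral_ofReal
    (integrableOn_rpow_mul_exp_neg_mul_rpow hq two_pos hb)]
  · refine setLIntegral_congr_fun measurableSet_Ioi fun r hr ↦ ?_
    have hr' : (0 : ℝ) < r := hr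
    rw [← ENNReal.ofReal_mul (by positivity), ← Nat.cast_pred hn, Real.rpow_natCast,
      Real.rpow_two]
  · filter_upwards [ae_restrict_mem measurableSet_Ioi] with r hr
    have hr' : (0 : ℝ) < r := hr
    positivity

section Gaussian

variable {E : Type*} [NormedAddCommGroup E] [InnerProductSpace ℝ E]
  [FiniteDimensional ℝ E] [MeasurableSpace E] [BorelSpace E]

lemma lintegral_exp_neg_mul_sq {b : ℝ} (hb : 0 < b) :
    ∫⁻ z : ℝ, ENNReal.ofReal (Real.exp (-b * z ^ 2)) = ENNReal.ofReal √(Real.pi / b) := by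
  rw [← integral_gaussian, ofReal_integral_eq_lintegral_ofReal (integrable_exp_neg_mul_sq hb)]
  exact Filter.Eventually.of_forall fun z ↦ (Real.exp_pos _).le

lemma lintegral_exp_neg_sq_add_mul (y : ℝ) :
    ∫⁻ z : ℝ, ENNReal.ofReal (Real.exp (-z ^ 2 + z * y)) =
      ENNReal.ofReal √Real.pi * ENNReal.ofReal (Real.exp (y ^ 2 / 4)) := by
  have h := lintegral_exp_neg_mul_sq one_pos
  rw [div_one, ← lintegral_sub_right_eq_self _ (y / 2)] at h
  rw [← h, ← lintegral_mul_const _ (by fun_prop)]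
  refine lintegral_congr fun z ↦ ?_
  rw [← ENNReal.ofReal_mul (Real.exp_pos _).le, ← Real.exp_add]
  ring_nf

/-- Tilting a standard Gaussian by `exp (⟪u, x⟫² / 4)` along a unit vector `u` multiplies its
total mass by `√2`. -/
lemma lintegral_exp_inner_sq {u : E} (hu : ‖u‖ = 1) :
    ∫⁻ x : E, ENNReal.ofReal (Real.exp (-(1 / 2) * ‖x‖ ^ 2 + inner ℝ u x ^ 2 / 4)) =
      ENNReal.ofReal √2 * ∫⁻ x : E, ENNReal.ofReal (Real.exp (-(1 / 2) * ‖x‖ ^ 2)) := by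
  set G := ∫⁻ x : E, ENNReal.ofReal (Real.exp (-(1 / 2) * ‖x‖ ^ 2)) with hG
  have hpi : ENNReal.ofReal √Real.pi ≠ 0 := by
    simpa using Real.pi_pos
  refine (ENNReal.mul_right_inj hpi ENNReal.ofReal_ne_top).1 ?_
  calc
    _ = ∫⁻ x : E, ∫⁻ z : ℝ, ENNReal.ofReal
          (Real.exp (-(1 / 2) * ‖x‖ ^ 2 + (-z ^ 2 + z * inner ℝ u x))) := by
      rw [← lintegral_const_mul _ (by fun_prop)]
      refine lintegral_congr fun x ↦ ?_
      simp_rw [Real.exp_add (-(1 / 2) * ‖x‖ ^ 2), ENNReal.ofReal_mul (Real.exp_pos _).le]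
      rw [lintegral_const_mul _ (by fun_prop), lintegral_exp_neg_sq_add_mul]
      ring
    _ = ∫⁻ z : ℝ, ∫⁻ x : E, ENNReal.ofReal
          (Real.exp (-(1 / 2) * ‖x‖ ^ 2 + (-z ^ 2 + z * inner ℝ u x))) :=
      lintegral_lintegral_swap (by fun_prop)
    _ = ∫⁻ z : ℝ, ENNReal.ofReal (Real.exp (-(1 / 2) * z ^ 2)) * G := by
      refine lintegral_congr fun z ↦ ?_
      rw [hG, ← lintegral_sub_right_eq_self
        (fun x : E ↦ ENNReal.ofReal (Real.exp (-(1 / 2) * ‖x‖ ^ 2))) (z • u),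
        ← lintegral_const_mul _ (by fun_prop)]
      refine lintegral_congr fun x ↦ ?_
      rw [← ENNReal.ofReal_mul (Real.exp_pos _).le, ← Real.exp_add, norm_sub_sq_real,
        norm_smul, inner_smul_right, hu, real_inner_comm u x, mul_one, Real.norm_eq_abs, sq_abs]
      ring_nf
    _ = _ := by
      rw [lintegral_mul_const _ (by fun_prop), lintegral_exp_neg_mul_sq (by norm_num),
        ← mul_assoc, ← ENNReal.ofReal_mul (by positivity), ← Real.sqrt_mul Real.pi_pos.le]
      norm_num

lemma exp_le_one_sub_rpow_neg {n s : ℝ} (hn : 0 ≤ n) (hs : s < 2) :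
    Real.exp (n * s / 4) ≤ (1 - s / 2) ^ (-n / 2) := by
  have h : 0 < 1 - s / 2 := by linarith
  rw [Real.rpow_def_of_pos h, Real.exp_le_exp]
  nlinarith [Real.log_le_sub_one_of_pos h]

/-- The squared inner product of a unit vector with a uniform point on the sphere is
sub-exponential at scale `1 / dim E`. -/
lemma lintegral_toSphere_exp_inner_sq_le [Nontrivial E] {u : E} (hu : ‖u‖ = 1) :
    ∫⁻ v : sphere (0 : E) 1,
        ENNReal.ofReal (Real.exp (Module.finrank ℝ E * inner ℝ u (v : E) ^ 2 / 4))
        ∂(volume : Measure E).toSphere ≤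
      ENNReal.ofReal √2 * (volume : Measure E).toSphere Set.univ := by
  set n := Module.finrank ℝ E with hn
  have hn0 : 0 < n := Module.finrank_pos
  have key := lintegral_exp_inner_sq hu
  rw [lintegral_eq_lintegral_toSphere_Ioi (volume : Measure E)
      (f := fun x ↦ ENNReal.ofReal (Real.exp (-(1 / 2) * ‖x‖ ^ 2 + inner ℝ u x ^ 2 / 4)))
      (by fun_prop),
    lintegral_eq_lintegral_toSphere_Ioi (volume : Measure E)
      (f := fun x ↦ ENNReal.ofReal (Real.exp (-(1 / 2) * ‖x‖ ^ 2))) (by fun_prop)] at key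
  set R : ℝ := (1 / 2) ^ (-(n : ℝ) / 2) * (1 / 2) * Real.Gamma (n / 2) with hR
  have hRpos : 0 < R := by
    have : 0 < Real.Gamma ((n : ℝ) / 2) := Real.Gamma_pos_of_pos (by positivity)
    positivity
  have hR0 : ENNReal.ofReal R ≠ 0 := by simpa using hRpos
  have hnorm (v : sphere (0 : E) 1) : ‖(v : E)‖ = 1 := by simp
  have hrhs (v : sphere (0 : E) 1) :
      ∫⁻ r in Set.Ioi (0 : ℝ), ENNReal.ofReal (r ^ (n - 1)) *
        ENNReal.ofReal (Real.exp (-(1 / 2) * ‖r • (v : E)‖ ^ 2)) = ENNReal.ofReal R := by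
    rw [hR, ← lintegral_Ioi_pow_mul_exp_neg_mul_sq hn0 (by norm_num)]
    simp only [norm_smul, hnorm, mul_one, Real.norm_eq_abs, sq_abs]
  have hlhs (v : sphere (0 : E) 1) :
      ENNReal.ofReal R * ENNReal.ofReal (Real.exp (n * inner ℝ u (v : E) ^ 2 / 4)) ≤
      ∫⁻ r in Set.Ioi (0 : ℝ), ENNReal.ofReal (r ^ (n - 1)) *
        ENNReal.ofReal (Real.exp (-(1 / 2) * ‖r • (v : E)‖ ^ 2 +
          inner ℝ u (r • (v : E)) ^ 2 / 4)) := by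
    have hs : inner ℝ u (v : E) ^ 2 ≤ 1 := by
      have := abs_real_inner_le_norm u (v : E)
      rw [hu, hnorm, one_mul] at this
      exact (sq_le_one_iff_abs_le_one _).2 this
    set s := inner ℝ u (v : E) ^ 2 with hsdef
    have hb : 0 < 1 / 2 * (1 - s / 2) := by linarith
    have hcongr (r : ℝ) : -(1 / 2) * ‖r • (v : E)‖ ^ 2 + inner ℝ u (r • (v : E)) ^ 2 / 4 =
        -(1 / 2 * (1 - s / 2)) * r ^ 2 := by
      rw [norm_smul, inner_smul_right, hnorm, mul_one, Real.norm_eq_abs, sq_abs, hsdef]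
      ring
    simp_rw [hcongr]
    rw [lintegral_Ioi_pow_mul_exp_neg_mul_sq hn0 hb, ← ENNReal.ofReal_mul hRpos.le,
      Real.mul_rpow (by norm_num) (by linarith)]
    refine ENNReal.ofReal_le_ofReal ?_
    calc
      R * Real.exp (n * s / 4) ≤ R * (1 - s / 2) ^ (-(n : ℝ) / 2) := by
        gcongr
        exact exp_le_one_sub_rpow_neg (by positivity) (by linarith)
      _ = _ := by rw [hR]; ring
  simp only [← hn, hrhs] at key
  rw [lintegral_const, mul_left_comm] at key
  refine (ENNReal.mul_le_mul_iff_right hR0 ENNReal.ofReal_ne_top).1 ?_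
  rw [← key, ← lintegral_const_mul _ (by fun_prop)]
  exact lintegral_mono hlhs

end Gaussian

lemma isProbabilityMeasure_uniformSphere_s17 {d : ℕ} (hd : 0 < d) :
    IsProbabilityMeasure (uniformSphere d) := by
  have : Nonempty (Fin d) := ⟨⟨0, hd⟩⟩
  refine ⟨?_⟩
  rw [uniformSphere, Measure.smul_apply, Measure.map_apply measurable_subtype_coe .univ,
    Set.preimage_univ, smul_eq_mul]
  exact ENNReal.inv_mul_cancel (Measure.measure_univ_ne_zero.2 (Measure.toSphere_ne_zero _))
    (measure_ne_top _ _)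

lemma lintegral_uniformSphere_exp_inner_sq_le {d : ℕ} (hd : 0 < d)
    {u : EuclideanSpace ℝ (Fin d)} (hu : ‖u‖ = 1) :
    ∫⁻ v, ENNReal.ofReal (Real.exp (d * (∑ k, u k * v k) ^ 2 / 4)) ∂uniformSphere d ≤
      ENNReal.ofReal √2 := by
  have : Nonempty (Fin d) := ⟨⟨0, hd⟩⟩
  have h := lintegral_toSphere_exp_inner_sq_le hu
  have hinner (v : EuclideanSpace ℝ (Fin d)) : inner ℝ u v = ∑ k, u k * v k := by
    simp [PiLp.inner_apply, mul_comm]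
  simp_rw [finrank_euclideanSpace_fin, hinner] at h
  rw [uniformSphere, lintegral_smul_measure, lintegral_map (by fun_prop) measurable_subtype_coe,
    smul_eq_mul]
  refine (mul_le_mul_right h _).trans ?_
  rw [mul_left_comm, ENNReal.inv_mul_cancel 
    (Measure.measure_univ_ne_zero.2 (Measure.toSphere_ne_zero _)) (measure_ne_top _ _), mul_one]

/-- If `X ≤ s²` and `l X ≤ n s / 8`, then `exp (l X)` is controlled by `exp (n s / 4)`. -/
lemma exp_mul_le_one_add_exp {n l s X : ℝ} (hn : 0 < n) (hl : 0 ≤ l) (hs : 0 ≤ s)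
    (hX : X ≤ s ^ 2) (hlX : l * X ≤ n * s / 8) :
    Real.exp (l * X) ≤ 1 + 128 * (l / n ^ 2) * Real.exp (n * s / 4) := by
  have h1 : Real.exp (l * X) ≤ 1 + l * X * Real.exp (l * X) := by
    have := mul_le_mul_of_nonneg_right (Real.one_sub_le_exp_neg (l * X)) (Real.exp_pos (l * X)).le
    rw [← Real.exp_add, neg_add_cancel, Real.exp_zero] at this
    linarith
  have h2 : s ^ 2 ≤ 128 / n ^ 2 * Real.exp (n * s / 8) := by
    have := Real.quadratic_le_exp_of_nonneg (x := n * s / 8) (by positivity)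
    have h3 : (n * s / 8) ^ 2 / 2 ≤ Real.exp (n * s / 8) := by
      have : 0 ≤ n * s / 8 := by positivity
      linarith
    calc
      s ^ 2 = 128 / n ^ 2 * ((n * s / 8) ^ 2 / 2) := by field_simp; ring
      _ ≤ _ := by gcongr
  calc
    Real.exp (l * X) ≤ 1 + l * X * Real.exp (l * X) := h1
    _ ≤ 1 + l * (128 / n ^ 2 * Real.exp (n * s / 8)) * Real.exp (n * s / 8) := by
      gcongr
      exact hX.trans h2
    _ = 1 + 128 * (l / n ^ 2) * (Real.exp (n * s / 8) * Real.exp (n * s / 8)) := by ring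
    _ = _ := by rw [← Real.exp_add]; ring_nf

lemma rpow_mul_min_le {n t : ℝ} (hn : 8 ^ 8 ≤ n) :
    n ^ (9 / 8 : ℝ) * min (t ^ 4) (n ^ (-(1 : ℝ) / 2)) ≤ n * t ^ 2 / 8 := by
  have hn0 : 0 < n := lt_of_lt_of_le (by norm_num) hn
  have hroot : 8 ≤ n ^ (1 / 8 : ℝ) := by
    calc
      (8 : ℝ) = ((8 : ℝ) ^ 8) ^ (1 / 8 : ℝ) := by
        rw [← Real.rpow_natCast, ← Real.rpow_mul (by norm_num)]; norm_num
      _ ≤ _ := by gcongr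
  have hmin : min (t ^ 4) (n ^ (-(1 : ℝ) / 2)) ≤ n ^ (-(1 : ℝ) / 4) * t ^ 2 := by
    have hsq : n ^ (-(1 : ℝ) / 2) = (n ^ (-(1 : ℝ) / 4)) ^ 2 := by
      rw [← Real.rpow_natCast, ← Real.rpow_mul hn0.le]; norm_num
    have hw : 0 < n ^ (-(1 : ℝ) / 4) := by positivity
    rcases le_total (t ^ 2) (n ^ (-(1 : ℝ) / 4)) with h | h
    · refine (min_le_left _ _).trans ?_
      nlinarith [sq_nonneg t]
    · refine (min_le_right _ _).trans ?_
      rw [hsq]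
      nlinarith
  calc
    _ ≤ n ^ (9 / 8 : ℝ) * (n ^ (-(1 : ℝ) / 4) * t ^ 2) := by gcongr
    _ = n ^ (7 / 8 : ℝ) * t ^ 2 := by
      rw [← mul_assoc, ← Real.rpow_add hn0]; norm_num
    _ ≤ n ^ (7 / 8 : ℝ) * (n ^ (1 / 8 : ℝ) / 8) * t ^ 2 := by
      gcongr
      refine le_mul_of_one_le_right (by positivity) ?_
      linarith
    _ = n ^ (7 / 8 + 1 / 8 : ℝ) * t ^ 2 / 8 := by rw [Real.rpow_add hn0]; ring
    _ = _ := by norm_num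

lemma lintegral_uniformSphere_exp_truncated_le {d : ℕ} (hd : 8 ^ 8 ≤ d)
    {u : EuclideanSpace ℝ (Fin d)} (hu : ‖u‖ = 1) :
    ∫⁻ v, ENNReal.ofReal (Real.exp ((d : ℝ) ^ (9 / 8 : ℝ) *
        min ((∑ k, u k * v k) ^ 4) ((d : ℝ) ^ (-(1 : ℝ) / 2)))) ∂uniformSphere d ≤
      ENNReal.ofReal (Real.exp (200 * ((d : ℝ) ^ (9 / 8 : ℝ) / (d : ℝ) ^ 2))) := by
  have hd0 : 0 < d := lt_of_lt_of_le (by norm_num) hd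
  have hd' : (8 : ℝ) ^ 8 ≤ d := by exact_mod_cast hd
  have hdpos : (0 : ℝ) < d := by exact_mod_cast hd0
  have := isProbabilityMeasure_uniformSphere_s17 hd0
  set q := (d : ℝ) ^ (9 / 8 : ℝ) / (d : ℝ) ^ 2 with hq
  have hq0 : 0 ≤ q := by positivity
  calc
    _ ≤ ∫⁻ v, (1 + ENNReal.ofReal (128 * q) *
          ENNReal.ofReal (Real.exp (d * (∑ k, u k * v k) ^ 2 / 4))) ∂uniformSphere d := by
      refine lintegral_mono fun v ↦ ?_
      rw [← ENNReal.ofReal_mul (by positivity), ← ENNReal.ofReal_one,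
        ← ENNReal.ofReal_add one_pos.le (by positivity)]
      refine ENNReal.ofReal_le_ofReal
        (exp_mul_le_one_add_exp hdpos (by positivity) (sq_nonneg _) ?_ (rpow_mul_min_le hd'))
      exact (min_le_left _ _).trans_eq (by ring)
    _ ≤ 1 + ENNReal.ofReal (128 * q) * ENNReal.ofReal √2 := by
      rw [lintegral_add_left measurable_const, lintegral_const_mul _ (by fun_prop),
        lintegral_const, measure_univ, one_mul]
      gcongr
      exact lintegral_uniformSphere_exp_inner_sq_le hd0 hu
    _ ≤ _ := by
      rw [← ENNReal.ofReal_mul (by positivity), ← ENNReal.ofReal_one,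
        ← ENNReal.ofReal_add one_pos.le (by positivity)]
      refine ENNReal.ofReal_le_ofReal ?_
      have h2 : √2 ≤ 3 / 2 := Real.sqrt_le_iff.2 (by norm_num)
      nlinarith [Real.add_one_le_exp (200 * q)]

/-- The Chernoff bound for a sum of i.i.d. copies of `f`, in product form. -/
lemma measure_pi_lt_sum_le {ι Ω : Type*} [Fintype ι] [MeasurableSpace Ω] (μ : Measure Ω)
    [IsProbabilityMeasure μ] {f : Ω → ℝ} (hf : Measurable f) {l K : ℝ} (hl : 0 ≤ l) (a : ℝ)
    (hK : ∫⁻ x, ENNReal.ofReal (Real.exp (l * f x)) ∂μ ≤ ENNReal.ofReal (Real.exp K)) :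
    (Measure.pi fun _ : ι ↦ μ) {x | a < ∑ i, f (x i)} ≤
      ENNReal.ofReal (Real.exp (Fintype.card ι * K - l * a)) := by
  set g : Ω → ℝ≥0∞ := fun x ↦ ENNReal.ofReal (Real.exp (l * f x)) with hg
  have hgm : Measurable g := by fun_prop
  have hprod : ∫⁻ x, ∏ i, g (x i) ∂(Measure.pi fun _ : ι ↦ μ) = ∏ _i : ι, ∫⁻ x, g x ∂μ := by
    rw [lintegral_prod_eq_prod_lintegral_of_indepFun Finset.univ (fun i (x : ι → Ω) ↦ g (x i))
      (iIndepFun_pi fun _ ↦ hgm.aemeasurable) fun i ↦ hgm.comp (measurable_pi_apply i)]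
    refine Finset.prod_congr rfl fun i _ ↦ ?_
    exact (measurePreserving_eval (fun _ : ι ↦ μ) i).lintegral_comp hgm
  have hpow : ∏ _i : ι, ∫⁻ x, g x ∂μ ≤ ENNReal.ofReal (Real.exp (Fintype.card ι * K)) := by
    rw [Finset.prod_const, Real.exp_nat_mul, ENNReal.ofReal_pow (Real.exp_pos _).le]
    exact pow_le_pow_left' hK _
  have hpoint (x : ι → Ω) (hx : a < ∑ i, f (x i)) :
      ENNReal.ofReal (Real.exp (l * a)) ≤ ∏ i, g (x i) := by
    rw [hg, ← ENNReal.ofReal_prod_of_nonneg fun i _ ↦ (Real.exp_pos _).le, ← Real.exp_sum,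
      ← Finset.mul_sum]
    gcongr
  calc
    _ ≤ (Measure.pi fun _ : ι ↦ μ) {x | ENNReal.ofReal (Real.exp (l * a)) ≤ ∏ i, g (x i)} :=
      measure_mono hpoint
    _ ≤ (∫⁻ x, ∏ i, g (x i) ∂(Measure.pi fun _ : ι ↦ μ)) / ENNReal.ofReal (Real.exp (l * a)) :=
      meas_ge_le_lintegral_div
        (Finset.measurable_prod _ fun i _ ↦ hgm.comp (measurable_pi_apply i)).aemeasurable
        (by simp [Real.exp_pos]) ENNReal.ofReal_ne_top
    _ ≤ ENNReal.ofReal (Real.exp (Fintype.card ι * K)) / ENNReal.ofReal (Real.exp (l * a)) := by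
      rw [hprod]
      gcongr
    _ = _ := by rw [← ENNReal.ofReal_div_of_pos (Real.exp_pos _), ← Real.exp_sub]

/-- There are `C > 0`, `c > 0` and `d₀` such that for all `d ≥ d₀`, positive `m ≤ d²`, and
every unit vector `u`: if `v⁽¹⁾,…,v⁽ᵐ⁾` are i.i.d. uniform on the sphere, then
`Pr(Σ_i min((u·v⁽ⁱ⁾)⁴, d^{−1/2}) > C·m/d²) ≤ exp(−c·m/d^{7/8})`. -/
theorem light_part_l2_bound :
    ∃ C : ℝ, 0 < C ∧ ∃ c : ℝ, 0 < c ∧ ∃ d₀ : ℕ, ∀ d : ℕ, d₀ ≤ d →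
      ∀ m : ℕ, 1 ≤ m → m ≤ d ^ 2 →
      ∀ u : EuclideanSpace ℝ (Fin d), ‖u‖ = 1 →
        (Measure.pi fun _ : Fin m => uniformSphere d)
            {v : Fin m → EuclideanSpace ℝ (Fin d) |
              C * m / (d : ℝ) ^ 2 <
                ∑ i, min ((∑ k, u k * v i k) ^ 4) ((d : ℝ) ^ (-(1 : ℝ) / 2))} ≤
          ENNReal.ofReal (Real.exp (-(c * m / (d : ℝ) ^ ((7 : ℝ) / 8)))) := by
  refine ⟨201, by norm_num, 1, one_pos, 8 ^ 8, fun d hd m _ _ u hu ↦ ?_⟩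
  have hd0 : 0 < d := lt_of_lt_of_le (by norm_num) hd
  have hdpos : (0 : ℝ) < d := by exact_mod_cast hd0
  have := isProbabilityMeasure_uniformSphere_s17 hd0
  refine (measure_pi_lt_sum_le (ι := Fin m) (uniformSphere d) (by fun_prop) (by positivity) _
    (lintegral_uniformSphere_exp_truncated_le hd hu)).trans ?_
  refine ENNReal.ofReal_le_ofReal (Real.exp_le_exp.2 (le_of_eq ?_))
  have hscale : (d : ℝ) ^ (9 / 8 : ℝ) / (d : ℝ) ^ 2 = 1 / (d : ℝ) ^ (7 / 8 : ℝ) := by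
    rw [← Real.rpow_natCast, ← Real.rpow_sub hdpos, one_div, ← Real.rpow_neg hdpos.le]
    norm_num
  rw [Fintype.card_fin]
  linear_combination (-m : ℝ) * hscale
end
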